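/- For every dimension d ∈ ℕ and all reals 0 < λ^- ≤ λ^+ there exists a constant c > 0 (depending only on d, λ^-, λ^+) with the following property: for every instance (k,X,Ω,A,K) of weight-constrained anisotropic clustering in ℝ^d in which every matrix A_i has all eigenvalues in [λ^-,λ^+], and for every ε ∈ (0,1/2] and every δ ≥ λ^+(A)/λ^-(A), there exists an (ε,δ)-coreset (X̃,Ω̃) for (k,X,Ω,A,K) whose number of points ñ satisfies ñ ≤ c·k²/ε^{d+1}. -/

import Mathlib

open Finset Matrix

noncomputable section

/-- Squared anisotropic (ellipsoidal) norm `‖v‖_A² = vᵀ A v`. -/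
def anormSq {d : ℕ} (A : Matrix (Fin d) (Fin d) ℝ) (v : Fin d → ℝ) : ℝ :=
  v ⬝ᵥ A.mulVec v

/-- `ξ` is a (fractional) `k`-clustering of `n` points. -/
def IsClustering {k n : ℕ} (ξ : Fin k → Fin n → ℝ) : Prop :=
  (∀ i j, 0 ≤ ξ i j) ∧ ∀ j, ∑ i, ξ i j = 1

/-- The weight `ω(C_i)` of the `i`-th cluster. -/
def clusterWeight {k n : ℕ} (ω : Fin n → ℝ) (ξ : Fin k → Fin n → ℝ) (i : Fin k) : ℝ :=
  ∑ j, ξ i j * ω j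

/-- `ξ` is a weight-constrained `k`-clustering (an element of `C_K(k,X,Ω)`). -/
def IsWCC {k n : ℕ} (κlo κhi : Fin k → ℝ) (ω : Fin n → ℝ) (ξ : Fin k → Fin n → ℝ) : Prop :=
  IsClustering ξ ∧ ∀ i, κlo i ≤ clusterWeight ω ξ i ∧ clusterWeight ω ξ i ≤ κhi i

/-- `cost_{A,K}(X,C,S)`. -/
def cost {d k n : ℕ} (A : Fin k → Matrix (Fin d) (Fin d) ℝ)
    (x : Fin n → Fin d → ℝ) (ω : Fin n → ℝ) (ξ : Fin k → Fin n → ℝ)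
    (s : Fin k → Fin d → ℝ) : ℝ :=
  ∑ i, ∑ j, ξ i j * ω j * anormSq (A i) (x j - s i)

/-- `cost_{A,K}(X,S)`: optimal constrained assignment cost for fixed sites `s`. -/
def assignCost {d k n : ℕ} (κlo κhi : Fin k → ℝ) (A : Fin k → Matrix (Fin d) (Fin d) ℝ)
    (x : Fin n → Fin d → ℝ) (ω : Fin n → ℝ) (s : Fin k → Fin d → ℝ) : ℝ :=
  sInf {c : ℝ | ∃ ξ, IsWCC κlo κhi ω ξ ∧ c = cost A x ω ξ s}

/-- `cost_{A,K}(X,C)`: infimum over site tuples. -/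
def clusterCost {d k n : ℕ} (A : Fin k → Matrix (Fin d) (Fin d) ℝ)
    (x : Fin n → Fin d → ℝ) (ω : Fin n → ℝ) (ξ : Fin k → Fin n → ℝ) : ℝ :=
  sInf {c : ℝ | ∃ s : Fin k → Fin d → ℝ, c = cost A x ω ξ s}

/-- `OPT_{A,K}(X)`. -/
def OPTc {d k n : ℕ} (κlo κhi : Fin k → ℝ) (A : Fin k → Matrix (Fin d) (Fin d) ℝ)
    (x : Fin n → Fin d → ℝ) (ω : Fin n → ℝ) : ℝ :=
  sInf {c : ℝ | ∃ ξ, IsWCC κlo κhi ω ξ ∧ c = clusterCost A x ω ξ}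

/-- Unconstrained optimum `OPT_A(X)` (over all clusterings and all site tuples). -/
def OPTu {d k n : ℕ} (A : Fin k → Matrix (Fin d) (Fin d) ℝ)
    (x : Fin n → Fin d → ℝ) (ω : Fin n → ℝ) : ℝ :=
  sInf {c : ℝ | ∃ ξ, ∃ s : Fin k → Fin d → ℝ, IsClustering ξ ∧ c = cost A x ω ξ s}

/-- `(X',Ω')` is an `(ε,δ)`-coreset for `(k,X,Ω,A,K)`, witnessed by the extension `f`
and the offsets `Δp`, `Δm`. -/
def IsCoresetWith {d k n m : ℕ} (ε δ : ℝ) (κlo κhi : Fin k → ℝ)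
    (A : Fin k → Matrix (Fin d) (Fin d) ℝ)
    (x : Fin n → Fin d → ℝ) (ω : Fin n → ℝ)
    (x' : Fin m → Fin d → ℝ) (ω' : Fin m → ℝ)
    (f : (Fin k → Fin m → ℝ) → (Fin k → Fin n → ℝ)) (Δp Δm : ℝ) : Prop :=
  0 ≤ Δp ∧ Δp ≤ δ * Δm ∧
  (∀ ξ', IsWCC κlo κhi ω' ξ' → IsWCC κlo κhi ω (f ξ')) ∧
  ∀ (s : Fin k → Fin d → ℝ) (ξ' : Fin k → Fin m → ℝ), IsWCC κlo κhi ω' ξ' →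
    (1 - ε) * cost A x ω (f ξ') s ≤ cost A x' ω' ξ' s + Δp ∧
    assignCost κlo κhi A x' ω' s + Δm ≤ (1 + ε) * assignCost κlo κhi A x ω s

section Partition

variable {ι : Type*}

/-- Weighted mean of `t` over the finite set `P`. -/
def wmean (ω t : ι → ℝ) (P : Finset ι) : ℝ :=
  (∑ j ∈ P, ω j * t j) / ∑ j ∈ P, ω j

/-- Weighted sum of squared deviations of `t` from its mean over the finite set `P`. -/
def wvar (ω t : ι → ℝ) (P : Finset ι) : ℝ :=
  ∑ j ∈ P, ω j * (t j - wmean ω t P) ^ 2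

theorem wvar_le (ω t : ι → ℝ) (hω : ∀ j, 0 < ω j) (P : Finset ι) (c : ℝ) :
    wvar ω t P ≤ ∑ j ∈ P, ω j * (t j - c) ^ 2 := by
  rcases P.eq_empty_or_nonempty with rfl | hP
  · simp [wvar]
  have hW : 0 < ∑ j ∈ P, ω j := Finset.sum_pos (fun j _ => hω j) hP
  have hm : wmean ω t P * ∑ j ∈ P, ω j = ∑ j ∈ P, ω j * t j := by
    unfold wmean; field_simp
  set μ := wmean ω t P with hμ
  have key : ∑ j ∈ P, ω j * (t j - c) ^ 2 =
      wvar ω t P + (∑ j ∈ P, ω j) * (μ - c) ^ 2 := by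
    have h1 : ∑ j ∈ P, ω j * (t j - c) ^ 2 = ∑ j ∈ P, (ω j * (t j - μ) ^ 2
        + ω j * (μ - c) ^ 2 + 2 * (μ - c) * (ω j * t j) - 2 * (μ - c) * μ * ω j) :=
      Finset.sum_congr rfl fun j _ => by ring
    rw [h1, Finset.sum_sub_distrib, Finset.sum_add_distrib, Finset.sum_add_distrib,
      ← Finset.mul_sum, ← Finset.mul_sum, ← Finset.sum_mul, ← hm]
    unfold wvar
    rw [← hμ]
    ring
  rw [key]
  have := mul_nonneg hW.le (sq_nonneg (μ - c))
  linarith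

theorem wvar_nonneg (ω t : ι → ℝ) (hω : ∀ j, 0 < ω j) (P : Finset ι) : 0 ≤ wvar ω t P :=
  Finset.sum_nonneg fun j _ => mul_nonneg (hω j).le (sq_nonneg _)

theorem wvar_add_le_union [DecidableEq ι] (ω t : ι → ℝ) (hω : ∀ j, 0 < ω j) {P Q : Finset ι}
    (h : Disjoint P Q) : wvar ω t P + wvar ω t Q ≤ wvar ω t (P ∪ Q) := by
  have : wvar ω t (P ∪ Q) = ∑ j ∈ P, ω j * (t j - wmean ω t (P ∪ Q)) ^ 2
      + ∑ j ∈ Q, ω j * (t j - wmean ω t (P ∪ Q)) ^ 2 := by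
    rw [wvar, Finset.sum_union h]
  rw [this]
  exact add_le_add (wvar_le ω t hω P _) (wvar_le ω t hω Q _)

theorem wvar_mono [DecidableEq ι] (ω t : ι → ℝ) (hω : ∀ j, 0 < ω j) {P Q : Finset ι} (h : P ⊆ Q) :
    wvar ω t P ≤ wvar ω t Q := by
  have h1 := wvar_add_le_union ω t hω (Finset.disjoint_sdiff (s := P) (t := Q))
  rw [Finset.union_sdiff_of_subset h] at h1
  linarith [wvar_nonneg ω t hω (Q \ P)]

/-- Greedy splitting of a weighted point set on the line into consecutive pieces of variance at
most `τ`. -/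
theorem exists_greedy_split [DecidableEq ι] (ω t : ι → ℝ) (hω : ∀ j, 0 < ω j) {τ : ℝ} (hτ : 0 ≤ τ)
    (P : Finset ι) : ∃ (r : ℕ) (b : ι → ℕ), (∀ p ∈ P, b p ≤ 2 * r) ∧
      (∀ p ∈ P, ∀ q ∈ P, b p < b q → t p ≤ t q) ∧
      (∀ v, wvar ω t (P.filter fun j => b j = v) ≤ τ) ∧
      (r = 0 ∨ r * τ < wvar ω t (P.filter fun j => b j < 2 * r)) := by
  induction P using Finset.induction_on_max_value t with
  | empty => exact ⟨0, fun _ => 0, by simp, by simp, by simp [wvar, hτ], Or.inl rfl⟩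
  | insert a s ha hmax ih =>
    obtain ⟨r, b, hb, hord, hvar, hr⟩ := ih
    have hne : ∀ x ∈ s, x ≠ a := fun x hx h => ha (h ▸ hx)
    by_cases hc : wvar ω t (insert a (s.filter fun j => b j = 2 * r)) ≤ τ
    · refine ⟨r, Function.update b a (2 * r), ?_, ?_, ?_, ?_⟩
      · intro p hp
        rcases Finset.mem_insert.1 hp with rfl | hp
        · simp
        · rw [Function.update_of_ne (hne p hp)]; exact hb p hp
      · intro p hp q hq hlt
        rcases Finset.mem_insert.1 hq with rfl | hq'
        · rcases Finset.mem_insert.1 hp with rfl | hp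
          · exact le_rfl
          · exact hmax p hp
        · rw [Function.update_of_ne (hne q hq')] at hlt
          rcases Finset.mem_insert.1 hp with rfl | hp
          · simp only [Function.update_self] at hlt
            have := hb q hq'
            omega
          · rw [Function.update_of_ne (hne p hp)] at hlt
            exact hord p hp q hq' hlt
      · intro v
        have hfs : (s.filter fun j => Function.update b a (2 * r) j = v)
            = s.filter fun j => b j = v :=
          Finset.filter_congr fun x hx => by rw [Function.update_of_ne (hne x hx)]
        rw [Finset.filter_insert, hfs, Function.update_self]
        split_ifs with h
        · rw [← h]; exact hc
        · exact hvar v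
      · have hfs : ((insert a s).filter fun j => Function.update b a (2 * r) j < 2 * r)
            = s.filter fun j => b j < 2 * r := by
          rw [Finset.filter_insert, Function.update_self, if_neg (lt_irrefl _)]
          exact Finset.filter_congr fun x hx => by rw [Function.update_of_ne (hne x hx)]
        rw [hfs]
        exact hr
    · push Not at hc
      refine ⟨r + 1, Function.update b a (2 * r + 1), ?_, ?_, ?_, Or.inr ?_⟩
      · intro p hp
        rcases Finset.mem_insert.1 hp with rfl | hp
        · simp
        · rw [Function.update_of_ne (hne p hp)]; have := hb p hp; omega
      · intro p hp q hq hlt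
        rcases Finset.mem_insert.1 hq with rfl | hq'
        · rcases Finset.mem_insert.1 hp with rfl | hp
          · exact le_rfl
          · exact hmax p hp
        · rw [Function.update_of_ne (hne q hq')] at hlt
          rcases Finset.mem_insert.1 hp with rfl | hp
          · simp only [Function.update_self] at hlt
            have := hb q hq'
            omega
          · rw [Function.update_of_ne (hne p hp)] at hlt
            exact hord p hp q hq' hlt
      · intro v
        have hfs : (s.filter fun j => Function.update b a (2 * r + 1) j = v)
            = s.filter fun j => b j = v :=
          Finset.filter_congr fun x hx => by rw [Function.update_of_ne (hne x hx)]
        rw [Finset.filter_insert, hfs, Function.update_self]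
        split_ifs with h
        · have : (s.filter fun j => b j = v) = ∅ := by
            apply Finset.filter_eq_empty_iff.2
            intro x hx hxv
            have := hb x hx
            omega
          rw [this]
          have := (hω a).ne'
          simp [wvar, wmean, this, hτ]
        · exact hvar v
      · have hfs : ((insert a s).filter fun j => Function.update b a (2 * r + 1) j < 2 * (r + 1))
            = (s.filter fun j => b j < 2 * r) ∪ insert a (s.filter fun j => b j = 2 * r) := by
          ext x
          simp only [Finset.mem_filter, Finset.mem_insert, Finset.mem_union]
          by_cases hxa : x = a
          · subst hxa; simp; omega
          · rw [Function.update_of_ne hxa]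
            constructor
            · rintro ⟨h | h, h2⟩
              · exact absurd h hxa
              · have := hb x h
                rcases this.lt_or_eq with h3 | h3
                · exact Or.inl ⟨h, h3⟩
                · exact Or.inr (Or.inr ⟨h, h3⟩)
            · rintro (⟨h, h2⟩ | h | ⟨h, h2⟩)
              · exact ⟨Or.inr h, by omega⟩
              · exact absurd h hxa
              · exact ⟨Or.inr h, by omega⟩
        have hd : Disjoint (s.filter fun j => b j < 2 * r)
            (insert a (s.filter fun j => b j = 2 * r)) := by
          rw [Finset.disjoint_left]
          intro x hx hx2
          simp only [Finset.mem_filter, Finset.mem_insert] at hx hx2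
          rcases hx2 with h | h
          · exact hne x hx.1 h
          · omega
        rw [hfs]
        have h1 := wvar_add_le_union ω t hω hd
        have h2 : r * τ ≤ wvar ω t (s.filter fun j => b j < 2 * r) := by
          rcases hr with h | h
          · subst h; simpa using wvar_nonneg ω t hω _
          · exact h.le
        push_cast
        linarith

/-- A weighted point set on the line splits into at most `2 N + 1` consecutive pieces each
carrying at most a `1 / N` fraction of the second moment. -/
theorem exists_split [DecidableEq ι] (ω t : ι → ℝ) (hω : ∀ j, 0 < ω j) {N : ℕ} (hN : 0 < N)
    (P : Finset ι) : ∃ b : ι → ℕ, (∀ p ∈ P, b p < 2 * N + 1) ∧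
      (∀ p ∈ P, ∀ q ∈ P, b p < b q → t p ≤ t q) ∧
      ∀ v, wvar ω t (P.filter fun j => b j = v) ≤ (∑ j ∈ P, ω j * t j ^ 2) / N := by
  have hN' : (0 : ℝ) < N := by exact_mod_cast hN
  have hV := wvar_nonneg ω t hω P
  obtain ⟨r, b, hb, hord, hvar, hr⟩ :=
    exists_greedy_split ω t hω (τ := wvar ω t P / N) (by positivity) P
  have hrN : r ≤ N := by
    rcases hr with h | h
    · omega
    · have h1 := h.trans_le (wvar_mono ω t hω (Finset.filter_subset _ P))
      by_contra! hcon
      have h2 : (N : ℝ) < r := by exact_mod_cast hcon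
      have h3 : N * (wvar ω t P / N) = wvar ω t P := by field_simp
      have h4 : 0 ≤ wvar ω t P / N := by positivity
      nlinarith
  refine ⟨b, fun p hp => by have := hb p hp; omega, hord, fun v => (hvar v).trans ?_⟩
  have := wvar_le ω t hω P 0
  simp only [sub_zero] at this
  gcongr

end Partition

section Envelope

variable {ι : Type*}

open Classical in
/-- An order-connected subset of the line cuts at most two of a family of consecutive batches. -/
theorem card_cut_le_two (P : Finset ι) (t : ι → ℝ) (b : ι → ℕ)
    (hord : ∀ p ∈ P, ∀ q ∈ P, b p < b q → t p ≤ t q) (I : Set ℝ) (hI : I.OrdConnected) :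
    ((P.image b).filter fun v => (∃ p ∈ P, b p = v ∧ t p ∈ I) ∧
      ∃ q ∈ P, b q = v ∧ t q ∉ I).card ≤ 2 := by
  set s := (P.image b).filter fun v => (∃ p ∈ P, b p = v ∧ t p ∈ I) ∧
      ∃ q ∈ P, b q = v ∧ t q ∉ I with hs
  rcases s.eq_empty_or_nonempty with h | h
  · simp [h]
  have hsub : s ⊆ {s.min' h, s.max' h} := by
    intro v hv
    by_contra hcon
    simp only [Finset.mem_insert, Finset.mem_singleton, not_or] at hcon
    have h1 : s.min' h < v := lt_of_le_of_ne (Finset.min'_le s v hv) (Ne.symm hcon.1)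
    have h2 : v < s.max' h := lt_of_le_of_ne (Finset.le_max' s v hv) hcon.2
    obtain ⟨p, hp, hpb, hpI⟩ := (Finset.mem_filter.1 (Finset.min'_mem s h)).2.1
    obtain ⟨r, hr, hrb, hrI⟩ := (Finset.mem_filter.1 (Finset.max'_mem s h)).2.1
    obtain ⟨q, hq, hqb, hqI⟩ := (Finset.mem_filter.1 hv).2.2
    exact hqI (hI.out hpI hrI ⟨hord p hp q hq (by omega), hord q hq r hr (by omega)⟩)
  exact (Finset.card_le_card hsub).trans Finset.card_le_two

theorem quad_sublevel {a b c t₁ t₂ t₃ : ℝ} (ha : 0 ≤ a) (h₁₂ : t₁ ≤ t₂) (h₂₃ : t₂ ≤ t₃) :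
    (a * t₂ ^ 2 + b * t₂ + c ≤ a * t₁ ^ 2 + b * t₁ + c) ∨
      (a * t₂ ^ 2 + b * t₂ + c ≤ a * t₃ ^ 2 + b * t₃ + c) := by
  by_contra! hcon
  obtain ⟨h1, h2⟩ := hcon
  have e1 : 0 < (t₂ - t₁) * (a * (t₂ + t₁) + b) := by nlinarith
  have e2 : (t₃ - t₂) * (a * (t₃ + t₂) + b) < 0 := by nlinarith
  have f1 : 0 < a * (t₂ + t₁) + b := pos_of_mul_pos_right e1 (by linarith)
  have f2 : 0 ≤ (t₃ - t₂) * (a * (t₃ + t₂) + b) := by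
    apply mul_nonneg (by linarith)
    nlinarith
  linarith

open Classical in
/-- Of a family of consecutive batches on a line, all but at most `4 k` lie uniformly with respect
to the lower envelope of `k` quadratic functions. -/
theorem exists_bad_batches {k : ℕ} (α β γ : Fin k → ℝ) (P : Finset ι) (t : ι → ℝ) (b : ι → ℕ)
    (hord : ∀ p ∈ P, ∀ q ∈ P, b p < b q → t p ≤ t q) :
    ∃ Bad : Finset ℕ, Bad.card ≤ 4 * k ∧ ∀ p ∈ P, ∀ q ∈ P, b p = b q → b p ∉ Bad →
      ∀ i, (∀ l, α i * t p ^ 2 + β i * t p + γ i ≤ α l * t p ^ 2 + β l * t p + γ l) →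
        ∀ l, α i * t q ^ 2 + β i * t q + γ i ≤ α l * t q ^ 2 + β l * t q + γ l := by
  set g : Fin k → ℝ → ℝ := fun i t => α i * t ^ 2 + β i * t + γ i with hg
  set r : Fin k → ℝ ×ₗ Fin k := fun i => toLex (α i, i) with hr
  have hrα : ∀ i l, r l < r i → α l ≤ α i := by
    intro i l h
    rcases Prod.Lex.toLex_lt_toLex.1 h with h | h
    · exact h.le
    · exact h.1.le
  have hrinj : ∀ i l, r l = r i → l = i := by
    intro i l h
    have := toLex.injective h
    exact (Prod.ext_iff.1 this).2
  set I : Fin k → Set ℝ := fun i => {t | ∀ l, r l < r i → g i t ≤ g l t} with hI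
  set J : Fin k → Set ℝ := fun i => {t | ∀ l, r l < r i → g i t < g l t} with hJ
  have hdiff : ∀ i l t, g i t - g l t =
      (α i - α l) * t ^ 2 + (β i - β l) * t + (γ i - γ l) := by
    intro i l t; simp only [hg]; ring
  have hIc : ∀ i, (I i).OrdConnected := by
    intro i
    refine ⟨fun t₁ h₁ t₃ h₃ t₂ ht l hl => ?_⟩
    have := h₁ l hl
    have := h₃ l hl
    have e₁ := hdiff i l t₁
    have e₂ := hdiff i l t₂
    have e₃ := hdiff i l t₃
    rcases quad_sublevel (a := α i - α l) (b := β i - β l) (c := γ i - γ l)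
      (by linarith [hrα i l hl]) ht.1 ht.2 with h | h <;> linarith
  have hJc : ∀ i, (J i).OrdConnected := by
    intro i
    refine ⟨fun t₁ h₁ t₃ h₃ t₂ ht l hl => ?_⟩
    have := h₁ l hl
    have := h₃ l hl
    have e₁ := hdiff i l t₁
    have e₂ := hdiff i l t₂
    have e₃ := hdiff i l t₃
    rcases quad_sublevel (a := α i - α l) (b := β i - β l) (c := γ i - γ l)
      (by linarith [hrα i l hl]) ht.1 ht.2 with h | h <;> linarith
  have hchar : ∀ i t, (∀ l, g i t ≤ g l t) ↔ t ∈ I i ∧ ∀ m, r i < r m → t ∉ J m := by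
    intro i t
    constructor
    · intro h
      exact ⟨fun l _ => h l, fun m hm hmJ => absurd (hmJ i hm) (not_lt.2 (h m))⟩
    · rintro ⟨h1, h2⟩
      by_contra! hcon
      obtain ⟨l, hl, hmin⟩ := Finset.exists_min_image
        (Finset.univ.filter fun l => g l t < g i t) r
        (by obtain ⟨l, hl⟩ := hcon; exact ⟨l, by simpa using hl⟩)
      have hl' : g l t < g i t := by simpa using hl
      rcases lt_trichotomy (r l) (r i) with h | h | h
      · exact absurd (h1 l h) (not_le.2 hl')
      · rw [hrinj i l h] at hl'; exact lt_irrefl _ hl'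
      · apply h2 l h
        intro m hm
        by_contra! hle
        have : r l ≤ r m := hmin m (by simpa using hle.trans_lt hl')
        exact absurd this (not_le.2 hm)
  set cut : Set ℝ → Finset ℕ := fun S => (P.image b).filter fun v =>
    (∃ p ∈ P, b p = v ∧ t p ∈ S) ∧ ∃ q ∈ P, b q = v ∧ t q ∉ S with hcut
  refine ⟨Finset.univ.biUnion fun i => cut (I i) ∪ cut (J i), ?_, ?_⟩
  · calc _ ≤ ∑ i : Fin k, (cut (I i) ∪ cut (J i)).card := Finset.card_biUnion_le
      _ ≤ ∑ i : Fin k, 4 := Finset.sum_le_sum fun i _ => (Finset.card_union_le _ _).trans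
          (by
            have h1 := card_cut_le_two P t b hord (I i) (hIc i)
            have h2 := card_cut_le_two P t b hord (J i) (hJc i)
            simp only [hcut]
            omega)
      _ = 4 * k := by simp [mul_comm]
  · intro p hp q hq hpq hbad i hi
    have hnot : ∀ i, b p ∉ cut (I i) ∧ b p ∉ cut (J i) := by
      intro i
      constructor <;> intro h <;> apply hbad <;>
        simp only [Finset.mem_biUnion, Finset.mem_union, Finset.mem_univ, true_and]
      · exact ⟨i, Or.inl h⟩
      · exact ⟨i, Or.inr h⟩
    have hpure : ∀ S, b p ∉ cut S → (t p ∈ S ↔ t q ∈ S) := by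
      intro S hS
      by_contra hcon
      apply hS
      simp only [hcut, Finset.mem_filter, Finset.mem_image]
      refine ⟨⟨p, hp, rfl⟩, ?_⟩
      by_cases h1 : t p ∈ S
      · exact ⟨⟨p, hp, rfl, h1⟩, q, hq, hpq.symm, by tauto⟩
      · exact ⟨⟨q, hq, hpq.symm, by tauto⟩, p, hp, rfl, h1⟩
    have h := (hchar i (t p)).1 hi
    apply (hchar i (t q)).2
    exact ⟨(hpure _ (hnot i).1).1 h.1, fun m hm hmJ => h.2 m hm ((hpure _ (hnot m).2).2 hmJ)⟩

end Envelope

section Duality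

theorem isCompact_clusterings (k n : ℕ) :
    IsCompact {ξ : Fin k → Fin n → ℝ | IsClustering ξ} := by
  have h : {ξ : Fin k → Fin n → ℝ | IsClustering ξ} =
      Set.Icc 0 1 ∩ {ξ | ∀ j, ∑ i, ξ i j = 1} := by
    ext ξ
    constructor
    · rintro ⟨h0, h1⟩
      refine ⟨⟨fun i j => h0 i j, fun i j => ?_⟩, h1⟩
      simp only [Pi.one_apply]
      rw [← h1 j]
      exact Finset.single_le_sum (f := fun i => ξ i j) (fun i _ => h0 i j) (Finset.mem_univ i)
    · rintro ⟨⟨h0, -⟩, h1⟩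
      exact ⟨fun i j => h0 i j, h1⟩
  rw [h]
  refine isCompact_Icc.inter_right ?_
  rw [Set.ofPred_forall]
  exact isClosed_iInter fun j => isClosed_eq (by fun_prop) continuous_const

theorem convex_clusterings (k n : ℕ) :
    Convex ℝ {ξ : Fin k → Fin n → ℝ | IsClustering ξ} := by
  rintro ξ ⟨h0, h1⟩ ζ ⟨g0, g1⟩ a b ha hb hab
  refine ⟨fun i j => ?_, fun j => ?_⟩
  · have := h0 i j
    have := g0 i j
    simp only [Pi.add_apply, Pi.smul_apply, smul_eq_mul]
    positivity
  · simp only [Pi.add_apply, Pi.smul_apply, smul_eq_mul, Finset.sum_add_distrib,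
      ← Finset.mul_sum, h1 j, g1 j]
    linarith

theorem sum_clusterWeight {k n : ℕ} (ω : Fin n → ℝ) {ξ : Fin k → Fin n → ℝ}
    (h : IsClustering ξ) : ∑ i, clusterWeight ω ξ i = ∑ j, ω j := by
  unfold clusterWeight
  rw [Finset.sum_comm]
  exact Finset.sum_congr rfl fun j _ => by rw [← Finset.sum_mul, h.2 j, one_mul]

/-- The pair of cluster weights and total assignment cost, as a linear map in the clustering. -/
def weightCost {k n : ℕ} (ω : Fin n → ℝ) (c : Fin k → Fin n → ℝ) :
    (Fin k → Fin n → ℝ) →ₗ[ℝ] (Fin k → ℝ) × ℝ where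
  toFun ξ := (fun i => clusterWeight ω ξ i, ∑ i, ∑ j, ξ i j * ω j * c i j)
  map_add' ξ ζ := by
    ext <;> simp [clusterWeight, add_mul, Finset.sum_add_distrib]
  map_smul' a ξ := by
    ext <;> simp [clusterWeight, mul_assoc, Finset.mul_sum]

/-- Approximate potentials for a weight-constrained assignment of minimal cost. -/
theorem exists_approx_potential {k n : ℕ} (ω : Fin n → ℝ) (c : Fin k → Fin n → ℝ)
    {ξ : Fin k → Fin n → ℝ} (hξ : IsClustering ξ)
    (hmin : ∀ ζ, IsClustering ζ → (∀ i, clusterWeight ω ζ i = clusterWeight ω ξ i) →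
      ∑ i, ∑ j, ξ i j * ω j * c i j ≤ ∑ i, ∑ j, ζ i j * ω j * c i j)
    {η : ℝ} (hη : 0 < η) :
    ∃ μ : Fin k → ℝ, ∀ ζ, IsClustering ζ →
      ∑ i, μ i * clusterWeight ω ξ i + (∑ i, ∑ j, ξ i j * ω j * c i j) - η ≤
        ∑ i, μ i * clusterWeight ω ζ i + ∑ i, ∑ j, ζ i j * ω j * c i j := by
  set T := weightCost ω c with hT
  have hTc : Continuous T := T.continuous_of_finiteDimensional
  set P := T '' {ξ | IsClustering ξ} with hP
  have hPc : IsCompact P := (isCompact_clusterings k n).image hTc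
  have hPconv : Convex ℝ P := (convex_clusterings k n).linear_image T
  set φ := ∑ i, ∑ j, ξ i j * ω j * c i j with hφ
  have hnot : ((fun i => clusterWeight ω ξ i, φ - η) : (Fin k → ℝ) × ℝ) ∉ P := by
    rintro ⟨ζ, hζ, he⟩
    have e1 := (Prod.ext_iff.1 he).1
    have e2 : ∑ i, ∑ j, ζ i j * ω j * c i j = φ - η := (Prod.ext_iff.1 he).2
    have := hmin ζ hζ fun i => congrFun e1 i
    linarith
  obtain ⟨f, u, hfu, hfP⟩ := geometric_hahn_banach_point_closed hPconv hPc.isClosed hnot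
  obtain ⟨ν, β, hf⟩ : ∃ (ν : Fin k → ℝ) (β : ℝ), ∀ (v : Fin k → ℝ) (r : ℝ),
      f (v, r) = ∑ i, ν i * v i + r * β := by
    refine ⟨fun i => f (Pi.single i 1, 0), f (0, 1), fun v r => ?_⟩
    have : ((v, r) : (Fin k → ℝ) × ℝ) =
        ∑ i, v i • ((Pi.single i 1, 0) : (Fin k → ℝ) × ℝ) + r • ((0, 1) : (Fin k → ℝ) × ℝ) := by
      ext i
      · simp [Prod.fst_sum, Finset.sum_apply, Pi.single_apply]
      · simp [Prod.snd_sum]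
    rw [this, map_add, map_sum, map_smul, smul_eq_mul]
    congr 1
    exact Finset.sum_congr rfl fun i _ => by rw [map_smul, smul_eq_mul, mul_comm]
  have hfζ : ∀ ζ, IsClustering ζ → f ((fun i => clusterWeight ω ξ i, φ - η)) <
      f ((fun i => clusterWeight ω ζ i), ∑ i, ∑ j, ζ i j * ω j * c i j) := by
    intro ζ hζ
    exact hfu.trans (hfP _ ⟨ζ, hζ, rfl⟩)
  have hβ : 0 < β := by
    have := hfζ ξ hξ
    rw [hf, hf] at this
    nlinarith
  refine ⟨fun i => ν i / β, fun ζ hζ => ?_⟩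
  have := hfζ ζ hζ
  rw [hf, hf] at this
  have hd : ∀ v : Fin k → ℝ, ∑ i, ν i / β * v i =
      (∑ i, ν i * v i) / β := by
    intro v
    rw [Finset.sum_div]
    exact Finset.sum_congr rfl fun i _ => by ring
  rw [hd, hd]
  rw [← sub_nonneg]
  have h3 := div_pos (sub_pos.2 this) hβ
  have h4 : ∀ a b x y : ℝ, (a + x * β - (b + y * β)) / β =
      a / β + x - (b / β + y) := by
    intro a b x y; field_simp
  rw [h4] at h3
  linarith

/-- A weight-preserving cost-minimal reassignment together with potentials satisfying
complementary slackness. -/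
theorem exists_potential {k n : ℕ} (ω : Fin n → ℝ) (hω : ∀ j, 0 < ω j)
    (c : Fin k → Fin n → ℝ) (hc : ∀ i j, 0 ≤ c i j)
    {ξ₀ : Fin k → Fin n → ℝ} (h₀ : IsClustering ξ₀) :
    ∃ (ξ : Fin k → Fin n → ℝ) (μ : Fin k → ℝ), IsClustering ξ ∧
      (∀ i, clusterWeight ω ξ i = clusterWeight ω ξ₀ i) ∧
      ∑ i, ∑ j, ξ i j * ω j * c i j ≤ ∑ i, ∑ j, ξ₀ i j * ω j * c i j ∧
      ∀ i j, 0 < ξ i j → ∀ l, c i j + μ i ≤ c l j + μ l := by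
  rcases Nat.eq_zero_or_pos k with rfl | hk
  · exact ⟨ξ₀, 0, h₀, fun _ => rfl, le_rfl, fun i => i.elim0⟩
  have : Nonempty (Fin k) := ⟨⟨0, hk⟩⟩
  have hcomp : IsCompact ({ξ : Fin k → Fin n → ℝ | IsClustering ξ} ∩
      {ξ | ∀ i, clusterWeight ω ξ i = clusterWeight ω ξ₀ i}) := by
    refine (isCompact_clusterings k n).inter_right ?_
    rw [Set.ofPred_forall]
    refine isClosed_iInter fun i => isClosed_eq ?_ continuous_const
    unfold clusterWeight
    fun_prop
  obtain ⟨ξ, ⟨hξ, hξw⟩, hξmin⟩ := hcomp.exists_isMinOn ⟨ξ₀, h₀, fun _ => rfl⟩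
    (f := fun ξ => ∑ i, ∑ j, ξ i j * ω j * c i j) (by fun_prop)
  have hmin : ∀ ζ, IsClustering ζ → (∀ i, clusterWeight ω ζ i = clusterWeight ω ξ i) →
      ∑ i, ∑ j, ξ i j * ω j * c i j ≤ ∑ i, ∑ j, ζ i j * ω j * c i j :=
    fun ζ hζ hw => hξmin ⟨hζ, fun i => (hw i).trans (hξw i)⟩
  set φ := ∑ i, ∑ j, ξ i j * ω j * c i j with hφ
  have hne : (Finset.univ : Finset (Fin k)).Nonempty := Finset.univ_nonempty
  obtain ⟨M, hM⟩ : ∃ M : ℝ, ∀ i j, c i j ≤ M := by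
    refine ⟨∑ i, ∑ j, c i j, fun i j => ?_⟩
    exact (Finset.single_le_sum (f := fun j => c i j) (fun j _ => hc i j)
      (Finset.mem_univ j)).trans (Finset.single_le_sum (f := fun i => ∑ j, c i j)
      (fun i _ => Finset.sum_nonneg fun j _ => hc i j) (Finset.mem_univ i))
  set G : (Fin k → ℝ) → Fin n → ℝ := fun μ j => Finset.univ.inf' hne fun i => c i j + μ i with hG
  set D : (Fin k → ℝ) → ℝ := fun μ => ∑ j, ω j * G μ j - ∑ i, μ i * clusterWeight ω ξ i with hD
  have hGle : ∀ μ i j, G μ j ≤ c i j + μ i := fun μ i j =>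
    Finset.inf'_le (fun i => c i j + μ i) (Finset.mem_univ i)
  have hDc : Continuous D := by
    refine Continuous.sub (continuous_finsetSum _ fun j _ => continuous_const.mul ?_) (by fun_prop)
    exact Continuous.finset_inf'_apply hne fun i _ => by fun_prop
  have hw0 : ∀ i, 0 ≤ clusterWeight ω ξ i := fun i =>
    Finset.sum_nonneg fun j _ => mul_nonneg (hξ.1 i j) (hω j).le
  have happrox : ∀ η : ℝ, 0 < η → ∃ μ ∈ Set.Icc (0 : Fin k → ℝ) (fun _ => max M 0),
      φ - η ≤ D μ := by
    intro η hη
    obtain ⟨μ, hμ⟩ := exists_approx_potential ω c hξ hmin hη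
    obtain ⟨i₀, -, hi₀⟩ := Finset.exists_min_image Finset.univ μ hne
    have hDμ : φ - η ≤ D μ := by
      choose τ hτ using fun j => Finset.exists_mem_eq_inf' hne fun i => c i j + μ i
      have hτ' : ∀ j, G μ j = c (τ j) j + μ (τ j) := fun j => (hτ j).2
      have := hμ (fun i j => if i = τ j then 1 else 0)
        ⟨fun i j => by dsimp only; split_ifs <;> norm_num, fun j => by simp⟩
      have e : ∑ i, μ i * clusterWeight ω (fun i j => if i = τ j then 1 else 0) i +
          ∑ i, ∑ j, (if i = τ j then (1 : ℝ) else 0) * ω j * c i j = ∑ j, ω j * G μ j := by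
        simp only [clusterWeight, Finset.mul_sum]
        rw [← Finset.sum_add_distrib]
        simp only [← Finset.sum_add_distrib]
        rw [Finset.sum_comm]
        refine Finset.sum_congr rfl fun j _ => ?_
        rw [Finset.sum_eq_single (τ j)]
        · rw [hτ']; simp; ring
        · intro i _ hi; simp [hi]
        · simp
      rw [e] at this
      simp only [hD]
      linarith
    refine ⟨fun i => min (μ i - μ i₀) (max M 0), ⟨fun i => ?_, fun i => min_le_right _ _⟩, ?_⟩
    · exact le_min (by have := hi₀ i (Finset.mem_univ i); simpa using this) (le_max_right _ _)
    · refine hDμ.trans ?_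
      simp only [hD]
      have h1 : ∀ j, G μ j - μ i₀ ≤ G (fun i => min (μ i - μ i₀) (max M 0)) j := by
        intro j
        refine Finset.le_inf' _ _ fun i _ => ?_
        rcases le_total (μ i - μ i₀) (max M 0) with h | h
        · simp only [min_eq_left h]; linarith [hGle μ i j]
        · simp only [min_eq_right h]
          linarith [hGle μ i₀ j, hM i₀ j, le_max_left M 0, hc i j]
      have h2 : ∑ j, ω j * (G μ j - μ i₀) ≤
          ∑ j, ω j * G (fun i => min (μ i - μ i₀) (max M 0)) j :=
        Finset.sum_le_sum fun j _ => mul_le_mul_of_nonneg_left (h1 j) (hω j).le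
      have h3 : ∑ i, min (μ i - μ i₀) (max M 0) * clusterWeight ω ξ i ≤
          ∑ i, (μ i - μ i₀) * clusterWeight ω ξ i :=
        Finset.sum_le_sum fun i _ => mul_le_mul_of_nonneg_right (min_le_left _ _) (hw0 i)
      simp only [mul_sub, sub_mul, Finset.sum_sub_distrib, ← Finset.sum_mul,
        ← Finset.mul_sum, sum_clusterWeight ω hξ] at h2 h3
      linarith
  obtain ⟨μ, -, hμmax⟩ := (isCompact_Icc (a := (0 : Fin k → ℝ)) (b := fun _ => max M 0)).exists_isMaxOn
    ⟨0, le_rfl, fun i => le_max_right _ _⟩ hDc.continuousOn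
  have hDφ : φ ≤ D μ := le_of_forall_pos_sub_le fun η hη => by
    obtain ⟨μ', hμ', h⟩ := happrox η hη
    exact h.trans (hμmax hμ')
  refine ⟨ξ, μ, hξ, hξw, hξmin ⟨h₀, fun _ => rfl⟩, ?_⟩
  have hnn : ∀ i j, 0 ≤ ξ i j * ω j * (c i j + μ i - G μ j) := fun i j =>
    mul_nonneg (mul_nonneg (hξ.1 i j) (hω j).le) (by linarith [hGle μ i j])
  have hsum : ∑ i, ∑ j, ξ i j * ω j * (c i j + μ i - G μ j) ≤ 0 := by
    have e1 : ∑ i, ∑ j, ξ i j * ω j * (c i j + μ i - G μ j) =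
        φ + ∑ i, μ i * clusterWeight ω ξ i - ∑ i, ∑ j, ξ i j * (ω j * G μ j) := by
      simp only [hφ, clusterWeight, Finset.mul_sum, ← Finset.sum_add_distrib,
        ← Finset.sum_sub_distrib]
      exact Finset.sum_congr rfl fun i _ => Finset.sum_congr rfl fun j _ => by ring
    have e2 : ∑ i, ∑ j, ξ i j * (ω j * G μ j) = ∑ j, ω j * G μ j := by
      rw [Finset.sum_comm]
      exact Finset.sum_congr rfl fun j _ => by rw [← Finset.sum_mul, hξ.2 j, one_mul]
    rw [e1, e2]
    simp only [hD] at hDφ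
    linarith
  intro i j hij l
  have h1 : ξ i j * ω j * (c i j + μ i - G μ j) ≤ 0 :=
    (Finset.single_le_sum (f := fun j => ξ i j * ω j * (c i j + μ i - G μ j))
      (fun j _ => hnn i j) (Finset.mem_univ j)).trans ((Finset.single_le_sum
      (f := fun i => ∑ j, ξ i j * ω j * (c i j + μ i - G μ j))
      (fun i _ => Finset.sum_nonneg fun j _ => hnn i j) (Finset.mem_univ i)).trans hsum)
  have h2 : 0 < ξ i j * ω j := mul_pos hij (hω j)
  have h3 : c i j + μ i - G μ j ≤ 0 := by
    by_contra! h
    exact absurd h1 (not_le.2 (mul_pos h2 h))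
  linarith [hGle μ l j]

end Duality

section Geometry

theorem anormSq_add {d : ℕ} (A : Matrix (Fin d) (Fin d) ℝ) (u v : Fin d → ℝ) :
    anormSq A (u + v) = anormSq A u + anormSq A v + (u ⬝ᵥ A *ᵥ v + v ⬝ᵥ A *ᵥ u) := by
  simp only [anormSq, Matrix.mulVec_add, dotProduct_add, add_dotProduct]
  ring

theorem anormSq_smul {d : ℕ} (A : Matrix (Fin d) (Fin d) ℝ) (r : ℝ) (v : Fin d → ℝ) :
    anormSq A (r • v) = r ^ 2 * anormSq A v := by
  simp only [anormSq, Matrix.mulVec_smul, dotProduct_smul, smul_dotProduct, smul_eq_mul]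
  ring

theorem anormSq_ray {d : ℕ} (A : Matrix (Fin d) (Fin d) ℝ) (a u s : Fin d → ℝ) (t : ℝ) :
    anormSq A (a + t • u - s) = anormSq A u * t ^ 2 +
      ((a - s) ⬝ᵥ A *ᵥ u + u ⬝ᵥ A *ᵥ (a - s)) * t + anormSq A (a - s) := by
  have : a + t • u - s = (a - s) + t • u := by abel
  rw [this, anormSq_add, anormSq_smul]
  simp only [Matrix.mulVec_smul, dotProduct_smul, smul_dotProduct, smul_eq_mul]
  ring

theorem anormSq_add_le {d : ℕ} {A : Matrix (Fin d) (Fin d) ℝ} (hA : ∀ v, 0 ≤ anormSq A v)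
    (u v : Fin d → ℝ) {η : ℝ} (hη : 0 < η) :
    anormSq A (u + v) ≤ (1 + η) * anormSq A u + (1 + 1 / η) * anormSq A v := by
  have h := hA (η • u + (-1 : ℝ) • v)
  rw [anormSq_add, anormSq_smul, anormSq_smul] at h
  simp only [Matrix.mulVec_smul, dotProduct_smul, smul_dotProduct, smul_eq_mul] at h
  rw [anormSq_add]
  have h2 : 0 ≤ (η ^ 2 * anormSq A u + anormSq A v
      - η * (u ⬝ᵥ A *ᵥ v + v ⬝ᵥ A *ᵥ u)) / η := by
    apply div_nonneg _ hη.le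
    linarith
  have h3 : (η ^ 2 * anormSq A u + anormSq A v
      - η * (u ⬝ᵥ A *ᵥ v + v ⬝ᵥ A *ᵥ u)) / η = η * anormSq A u + 1 / η * anormSq A v
      - (u ⬝ᵥ A *ᵥ v + v ⬝ᵥ A *ᵥ u) := by
    field_simp
  rw [h3] at h2
  linarith

theorem dotProduct_self_le_norm_sq {d : ℕ} (v : Fin d → ℝ) : v ⬝ᵥ v ≤ d * ‖v‖ ^ 2 := by
  calc v ⬝ᵥ v = ∑ i, v i ^ 2 := Finset.sum_congr rfl fun i _ => by ring
    _ ≤ ∑ _i : Fin d, ‖v‖ ^ 2 := Finset.sum_le_sum fun i _ => by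
        rw [← sq_abs]
        have := norm_le_pi_norm v i
        rw [Real.norm_eq_abs] at this
        gcongr
    _ = d * ‖v‖ ^ 2 := by simp

theorem norm_sq_le_dotProduct_self {d : ℕ} (v : Fin d → ℝ) : ‖v‖ ^ 2 ≤ v ⬝ᵥ v := by
  have hnn : 0 ≤ v ⬝ᵥ v := Finset.sum_nonneg fun i _ => mul_self_nonneg (v i)
  have : ‖v‖ ≤ √(v ⬝ᵥ v) := by
    rw [pi_norm_le_iff_of_nonneg (Real.sqrt_nonneg _)]
    intro i
    rw [Real.norm_eq_abs]
    apply Real.abs_le_sqrt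
    rw [sq]
    exact Finset.single_le_sum (f := fun i => v i * v i) (fun i _ => mul_self_nonneg (v i))
      (Finset.mem_univ i)
  calc ‖v‖ ^ 2 ≤ √(v ⬝ᵥ v) ^ 2 := by gcongr
    _ = _ := Real.sq_sqrt hnn

/-- Moving the points of a data set changes the cost of a clustering in a controlled way. -/
theorem cost_le_of_move {d k n : ℕ} {A : Fin k → Matrix (Fin d) (Fin d) ℝ}
    (hA : ∀ i v, 0 ≤ anormSq (A i) v) {Λ : ℝ} (hΛ : ∀ i v, anormSq (A i) v ≤ Λ * ‖v‖ ^ 2)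
    (y z : Fin n → Fin d → ℝ) {ω : Fin n → ℝ} (hω : ∀ j, 0 < ω j)
    {ξ : Fin k → Fin n → ℝ} (hξ : IsClustering ξ) (s : Fin k → Fin d → ℝ) {η : ℝ} (hη : 0 < η) :
    cost A y ω ξ s ≤ (1 + η) * cost A z ω ξ s
      + (1 + 1 / η) * (Λ * ∑ j, ω j * ‖y j - z j‖ ^ 2) := by
  have h1 : ∑ j, ω j * ‖y j - z j‖ ^ 2 = ∑ i, ∑ j, ξ i j * (ω j * ‖y j - z j‖ ^ 2) := by
    rw [Finset.sum_comm]
    exact Finset.sum_congr rfl fun j _ => by rw [← Finset.sum_mul, hξ.2 j, one_mul]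
  rw [h1, cost, cost]
  simp only [Finset.mul_sum, ← Finset.sum_add_distrib]
  refine Finset.sum_le_sum fun i _ => Finset.sum_le_sum fun j _ => ?_
  have h2 : y j - s i = (z j - s i) + (y j - z j) := by abel
  have h3 := anormSq_add_le (hA i) (z j - s i) (y j - z j) hη
  rw [← h2] at h3
  have h4 : (1 + 1 / η) * anormSq (A i) (y j - z j) ≤ (1 + 1 / η) * (Λ * ‖y j - z j‖ ^ 2) :=
    mul_le_mul_of_nonneg_left (hΛ i _) (by positivity)
  have h5 := mul_le_mul_of_nonneg_left (h3.trans (add_le_add_right h4 _))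
    (mul_nonneg (hξ.1 i j) (hω j).le)
  refine h5.trans (le_of_eq ?_)
  ring

theorem cost_nonneg {d k n : ℕ} {A : Fin k → Matrix (Fin d) (Fin d) ℝ}
    (hA : ∀ i v, 0 ≤ anormSq (A i) v) (x : Fin n → Fin d → ℝ) {ω : Fin n → ℝ}
    (hω : ∀ j, 0 < ω j) {ξ : Fin k → Fin n → ℝ} (hξ : IsClustering ξ) (s : Fin k → Fin d → ℝ) :
    0 ≤ cost A x ω ξ s :=
  Finset.sum_nonneg fun i _ => Finset.sum_nonneg fun j _ =>
    mul_nonneg (mul_nonneg (hξ.1 i j) (hω j).le) (hA i _)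

/-- Steiner's identity for the weighted centroid of a finite point set. -/
theorem sum_anormSq_centroid {d : ℕ} {ι : Type*} (A : Matrix (Fin d) (Fin d) ℝ) (S : Finset ι)
    (ω : ι → ℝ) (hW : ∑ j ∈ S, ω j ≠ 0) (x : ι → Fin d → ℝ) (s z : Fin d → ℝ)
    (hz : z = (∑ j ∈ S, ω j)⁻¹ • ∑ j ∈ S, ω j • x j) :
    ∑ j ∈ S, ω j * anormSq A (x j - s) =
      (∑ j ∈ S, ω j) * anormSq A (z - s) + ∑ j ∈ S, ω j * anormSq A (x j - z) := by
  have h0 : ∑ j ∈ S, ω j • (x j - z) = 0 := by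
    simp only [smul_sub, Finset.sum_sub_distrib, ← Finset.sum_smul]
    rw [hz, smul_smul, mul_inv_cancel₀ hW, one_smul, sub_self]
  have h1 : ∀ j, ω j * anormSq A (x j - s) = ω j * anormSq A (z - s) + ω j * anormSq A (x j - z)
      + ((z - s) ⬝ᵥ A *ᵥ (ω j • (x j - z)) + (ω j • (x j - z)) ⬝ᵥ A *ᵥ (z - s)) := by
    intro j
    have : x j - s = (z - s) + (x j - z) := by abel
    rw [this, anormSq_add]
    simp only [Matrix.mulVec_smul, dotProduct_smul, smul_dotProduct, smul_eq_mul]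
    ring
  simp only [h1, Finset.sum_add_distrib]
  rw [← dotProduct_sum, ← sum_dotProduct, ← Matrix.mulVec_sum, h0]
  simp [Finset.sum_mul]

end Geometry

section Averaging

variable {γ : Type*} [DecidableEq γ]

/-- Replace a clustering by its weighted average over each batch of points with the same label. -/
def batchAverage {k n : ℕ} (ω : Fin n → ℝ) (B : Fin n → γ) (ξ : Fin k → Fin n → ℝ) :
    Fin k → Fin n → ℝ := fun i j =>
  (∑ l with B l = B j, ξ i l * ω l) / ∑ l with B l = B j, ω l

theorem batch_weight_pos {n : ℕ} {ω : Fin n → ℝ} (hω : ∀ j, 0 < ω j) (B : Fin n → γ)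
    (j : Fin n) : 0 < ∑ l with B l = B j, ω l :=
  Finset.sum_pos (fun l _ => hω l) ⟨j, by simp⟩

theorem sum_batchAverage_mul {k n : ℕ} {ω : Fin n → ℝ} (hω : ∀ j, 0 < ω j) (B : Fin n → γ)
    (ξ : Fin k → Fin n → ℝ) (i : Fin k) (h : Fin n → ℝ) (hh : ∀ j l, B j = B l → h j = h l) :
    ∑ j, batchAverage ω B ξ i j * ω j * h j = ∑ j, ξ i j * ω j * h j := by
  have h1 : ∀ j, batchAverage ω B ξ i j * ω j * h j = ∑ l, if B l = B j then
      ξ i l * ω l * h l / (∑ m with B m = B l, ω m) * ω j else 0 := by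
    intro j
    rw [← Finset.sum_filter, batchAverage, Finset.sum_div, Finset.sum_mul, Finset.sum_mul]
    refine Finset.sum_congr rfl fun l hl => ?_
    have hl' : B l = B j := (Finset.mem_filter.1 hl).2
    rw [hh l j hl', hl']
    ring
  simp only [h1]
  rw [Finset.sum_comm]
  refine Finset.sum_congr rfl fun l _ => ?_
  have h2 := (batch_weight_pos hω B l).ne'
  rw [← Finset.sum_filter, ← Finset.mul_sum]
  have h3 : (Finset.univ.filter fun j => B l = B j) = Finset.univ.filter fun j => B j = B l :=
    Finset.filter_congr fun j _ => eq_comm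
  rw [h3]
  field_simp

theorem isClustering_batchAverage {k n : ℕ} {ω : Fin n → ℝ} (hω : ∀ j, 0 < ω j) (B : Fin n → γ)
    {ξ : Fin k → Fin n → ℝ} (hξ : IsClustering ξ) : IsClustering (batchAverage ω B ξ) := by
  refine ⟨fun i j => div_nonneg (Finset.sum_nonneg fun l _ => mul_nonneg (hξ.1 i l) (hω l).le)
    (batch_weight_pos hω B j).le, fun j => ?_⟩
  simp only [batchAverage]
  rw [← Finset.sum_div, Finset.sum_comm, div_eq_one_iff_eq (batch_weight_pos hω B j).ne']
  exact Finset.sum_congr rfl fun l _ => by rw [← Finset.sum_mul, hξ.2 l, one_mul]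

theorem clusterWeight_batchAverage {k n : ℕ} {ω : Fin n → ℝ} (hω : ∀ j, 0 < ω j) (B : Fin n → γ)
    (ξ : Fin k → Fin n → ℝ) (i : Fin k) :
    clusterWeight ω (batchAverage ω B ξ) i = clusterWeight ω ξ i := by
  simpa [clusterWeight] using sum_batchAverage_mul hω B ξ i (fun _ => 1) (fun _ _ _ => rfl)

/-- Averaging over batches is free if, on each batch, the assignment costs of all clusters used
there differ only by constants. -/
theorem sum_batchAverage_eq {k n : ℕ} {ω : Fin n → ℝ} (hω : ∀ j, 0 < ω j) (B : Fin n → γ)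
    {ξ : Fin k → Fin n → ℝ} (hξ : IsClustering ξ) (C : Fin k → Fin n → ℝ) (G : Fin n → ℝ)
    (ν : Fin k → Fin n → ℝ) (hν : ∀ i j l, B j = B l → ν i j = ν i l)
    (h : ∀ i j l, B j = B l → 0 < ξ i l → C i j = G j + ν i j) :
    ∑ i, ∑ j, batchAverage ω B ξ i j * ω j * C i j = ∑ i, ∑ j, ξ i j * ω j * C i j := by
  have hG : ∀ ζ : Fin k → Fin n → ℝ, IsClustering ζ →
      ∑ i, ∑ j, ζ i j * ω j * G j = ∑ j, ω j * G j := by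
    intro ζ hζ
    rw [Finset.sum_comm]
    refine Finset.sum_congr rfl fun j _ => ?_
    simp only [mul_assoc]
    rw [← Finset.sum_mul, hζ.2 j, one_mul]
  have h1 : ∀ i j, batchAverage ω B ξ i j * ω j * C i j =
      batchAverage ω B ξ i j * ω j * G j + batchAverage ω B ξ i j * ω j * ν i j := by
    intro i j
    by_cases h0 : ∃ l, B j = B l ∧ 0 < ξ i l
    · obtain ⟨l, hl, hl0⟩ := h0
      rw [h i j l hl hl0]; ring
    · push Not at h0
      have : batchAverage ω B ξ i j = 0 := by
        rw [batchAverage, Finset.sum_eq_zero, zero_div]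
        intro l hl
        have hl' : B l = B j := (Finset.mem_filter.1 hl).2
        rw [le_antisymm (h0 l hl'.symm) (hξ.1 i l), zero_mul]
      rw [this]; ring
  have h2 : ∀ i j, ξ i j * ω j * C i j = ξ i j * ω j * G j + ξ i j * ω j * ν i j := by
    intro i j
    rcases (hξ.1 i j).eq_or_lt with h0 | h0
    · rw [← h0]; ring
    · rw [h i j j rfl h0]; ring
  simp only [h1, h2, Finset.sum_add_distrib]
  rw [hG _ hξ, hG _ (isClustering_batchAverage hω B hξ)]
  congr 1
  exact Finset.sum_congr rfl fun i _ => sum_batchAverage_mul hω B ξ i (ν i) (hν i)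

/-- The weighted centroids of a labelled data set form a coreset as soon as averaging a suitable
clustering over the labels is cheap. -/
theorem exists_coreset_of_labels {d k n : ℕ} {lm lp : ℝ} (hlm : 0 < lm) (hlmp : lm ≤ lp)
    (x : Fin n → Fin d → ℝ) {ω : Fin n → ℝ} (hω : ∀ j, 0 < ω j) (κlo κhi : Fin k → ℝ)
    (A : Fin k → Matrix (Fin d) (Fin d) ℝ)
    (hlow : ∀ i (u : Fin d → ℝ), lm * (u ⬝ᵥ u) ≤ anormSq (A i) u)
    (hup : ∀ i (u : Fin d → ℝ), anormSq (A i) u ≤ lp * (u ⬝ᵥ u))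
    (hne : ∃ ξ, IsWCC κlo κhi ω ξ) {ε δ : ℝ} (hε : 0 < ε) (hδ : lp / lm ≤ δ)
    (B : Fin n → γ)
    (H : ∀ (s : Fin k → Fin d → ℝ) (ξ : Fin k → Fin n → ℝ), IsClustering ξ →
      ∃ ζ : Fin k → Fin n → ℝ, IsClustering ζ ∧
        (∀ i, clusterWeight ω ζ i = clusterWeight ω ξ i) ∧
        cost A x ω (batchAverage ω B ζ) s ≤ (1 + ε) * cost A x ω ξ s) :
    ∃ (x' : Fin (Finset.univ.image B).card → Fin d → ℝ)
      (ω' : Fin (Finset.univ.image B).card → ℝ), (∀ j', 0 < ω' j') ∧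
      ∃ f Δp Δm, IsCoresetWith ε δ κlo κhi A x ω x' ω' f Δp Δm := by
  set m := (Finset.univ.image B).card with hm
  have hA : ∀ i v, 0 ≤ anormSq (A i) v := fun i v =>
    (mul_nonneg hlm.le (Finset.sum_nonneg fun l _ => mul_self_nonneg (v l))).trans (hlow i v)
  obtain ⟨b, hbsurj, hbB⟩ : ∃ b : Fin n → Fin m, Function.Surjective b ∧
      ∀ j l, b j = b l ↔ B j = B l := by
    refine ⟨fun j => (Finset.univ.image B).equivFin
      ⟨B j, Finset.mem_image_of_mem B (Finset.mem_univ j)⟩, fun v => ?_, fun j l => ?_⟩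
    · obtain ⟨⟨g, hg⟩, rfl⟩ := (Finset.univ.image B).equivFin.surjective v
      obtain ⟨j, -, rfl⟩ := Finset.mem_image.1 hg
      exact ⟨j, rfl⟩
    · rw [EmbeddingLike.apply_eq_iff_eq, Subtype.mk.injEq]
  clear_value m
  set ω' : Fin m → ℝ := fun v => ∑ j with b j = v, ω j with hω'
  set x' : Fin m → Fin d → ℝ := fun v => (ω' v)⁻¹ • ∑ j with b j = v, ω j • x j with hx'
  have hω'pos : ∀ v, 0 < ω' v := by
    intro v
    obtain ⟨j, rfl⟩ := hbsurj v
    exact batch_weight_pos hω b j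
  have hfib : ∀ (ξ' : Fin k → Fin m → ℝ) (i : Fin k) (h : Fin n → ℝ),
      ∑ j, ξ' i (b j) * ω j * h j = ∑ v, ξ' i v * ∑ j with b j = v, ω j * h j := by
    intro ξ' i h
    rw [← Finset.sum_fiberwise (s := Finset.univ) (g := b)]
    refine Finset.sum_congr rfl fun v _ => ?_
    rw [Finset.mul_sum]
    refine Finset.sum_congr rfl fun j hj => ?_
    rw [(Finset.mem_filter.1 hj).2]; ring
  have hfw : ∀ (ξ' : Fin k → Fin m → ℝ) (i : Fin k),
      clusterWeight ω (fun i j => ξ' i (b j)) i = clusterWeight ω' ξ' i := by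
    intro ξ' i
    have := hfib ξ' i fun _ => 1
    simpa [clusterWeight, hω'] using this
  have hcost : ∀ (ξ' : Fin k → Fin m → ℝ) (s : Fin k → Fin d → ℝ),
      cost A x ω (fun i j => ξ' i (b j)) s = cost A x' ω' ξ' s
        + ∑ i, ∑ j, ξ' i (b j) * ω j * anormSq (A i) (x j - x' (b j)) := by
    intro ξ' s
    simp only [cost]
    rw [← Finset.sum_add_distrib]
    refine Finset.sum_congr rfl fun i _ => ?_
    rw [hfib ξ' i, hfib ξ' i, ← Finset.sum_add_distrib]
    refine Finset.sum_congr rfl fun v _ => ?_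
    rw [sum_anormSq_centroid (A i) _ ω (hω'pos v).ne' x (s i) (x' v) rfl]
    have : ∑ j with b j = v, ω j * anormSq (A i) (x j - x' (b j)) =
        ∑ j with b j = v, ω j * anormSq (A i) (x j - x' v) :=
      Finset.sum_congr rfl fun j hj => by rw [(Finset.mem_filter.1 hj).2]
    rw [this]
    ring
  set V : ℝ := ∑ j, ω j * ((x j - x' (b j)) ⬝ᵥ (x j - x' (b j))) with hV
  have hV0 : 0 ≤ V := Finset.sum_nonneg fun j _ => mul_nonneg (hω j).le
    (Finset.sum_nonneg fun l _ => mul_self_nonneg _)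
  have hVξ : ∀ ξ' : Fin k → Fin m → ℝ, IsClustering ξ' →
      V = ∑ i, ∑ j, ξ' i (b j) * ω j * ((x j - x' (b j)) ⬝ᵥ (x j - x' (b j))) := by
    intro ξ' hξ'
    rw [Finset.sum_comm]
    refine Finset.sum_congr rfl fun j _ => ?_
    simp only [mul_assoc]
    rw [← Finset.sum_mul, hξ'.2 (b j), one_mul]
  have hVup : ∀ ξ' : Fin k → Fin m → ℝ, IsClustering ξ' →
      ∑ i, ∑ j, ξ' i (b j) * ω j * anormSq (A i) (x j - x' (b j)) ≤ lp * V := by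
    intro ξ' hξ'
    rw [hVξ ξ' hξ', Finset.mul_sum]
    refine Finset.sum_le_sum fun i _ => ?_
    rw [Finset.mul_sum]
    refine Finset.sum_le_sum fun j _ => ?_
    have := mul_le_mul_of_nonneg_left (hup i (x j - x' (b j)))
      (mul_nonneg (hξ'.1 i (b j)) (hω j).le)
    linarith
  have hVlow : ∀ ξ' : Fin k → Fin m → ℝ, IsClustering ξ' →
      lm * V ≤ ∑ i, ∑ j, ξ' i (b j) * ω j * anormSq (A i) (x j - x' (b j)) := by
    intro ξ' hξ'
    rw [hVξ ξ' hξ', Finset.mul_sum]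
    refine Finset.sum_le_sum fun i _ => ?_
    rw [Finset.mul_sum]
    refine Finset.sum_le_sum fun j _ => ?_
    have := mul_le_mul_of_nonneg_left (hlow i (x j - x' (b j)))
      (mul_nonneg (hξ'.1 i (b j)) (hω j).le)
    linarith
  have hfcl : ∀ ξ' : Fin k → Fin m → ℝ, IsClustering ξ' →
      IsClustering fun i j => ξ' i (b j) :=
    fun ξ' h => ⟨fun i j => h.1 i (b j), fun j => h.2 (b j)⟩
  refine ⟨x', ω', hω'pos, fun ξ' i j => ξ' i (b j), lp * V, lm * V, ?_, ?_, ?_, ?_⟩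
  · exact mul_nonneg (hlm.le.trans hlmp) hV0
  · rw [← mul_assoc]
    exact mul_le_mul_of_nonneg_right ((div_le_iff₀ hlm).1 hδ) hV0
  · intro ξ' hξ'
    refine ⟨hfcl ξ' hξ'.1, fun i => ?_⟩
    rw [hfw]
    exact hξ'.2 i
  · intro s ξ' hξ'
    constructor
    · have h1 := cost_nonneg hA x hω (hfcl ξ' hξ'.1) s
      have h2 := hcost ξ' s
      have h3 := hVup ξ' hξ'.1
      nlinarith
    · have hε' : (0 : ℝ) < 1 + ε := by linarith
      rw [← div_le_iff₀' hε']
      obtain ⟨ξ₀, hξ₀⟩ := hne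
      refine le_csInf ⟨_, ξ₀, hξ₀, rfl⟩ ?_
      rintro _ ⟨ξ, hξ, rfl⟩
      rw [div_le_iff₀' hε']
      obtain ⟨ζ, hζ, hζw, hζc⟩ := H s ξ hξ.1
      set ρ := Function.surjInv hbsurj with hρ
      have hρb : ∀ v, b (ρ v) = v := Function.surjInv_eq hbsurj
      set ξ'' : Fin k → Fin m → ℝ := fun i v => batchAverage ω B ζ i (ρ v) with hξ''
      have he : (fun i j => ξ'' i (b j)) = batchAverage ω B ζ := by
        funext i j
        have : B (ρ (b j)) = B j := (hbB _ _).1 (hρb (b j))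
        simp only [hξ'', batchAverage, this]
      have hav := isClustering_batchAverage hω B hζ
      have hcl : IsClustering ξ'' := ⟨fun i v => hav.1 i _, fun v => hav.2 _⟩
      have hW : IsWCC κlo κhi ω' ξ'' := by
        refine ⟨hcl, fun i => ?_⟩
        rw [← hfw, he, clusterWeight_batchAverage hω, hζw]
        exact hξ.2 i
      have h1 : assignCost κlo κhi A x' ω' s ≤ cost A x' ω' ξ'' s := by
        refine csInf_le ⟨0, ?_⟩ ⟨ξ'', hW, rfl⟩
        rintro _ ⟨ξ₁, hξ₁, rfl⟩
        exact cost_nonneg hA x' hω'pos hξ₁.1 s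
      have h2 := hcost ξ'' s
      rw [he] at h2
      have h3 := hVlow ξ'' hcl
      linarith

end Averaging

section Construction

/-- A finite net of the unit sphere of the sup norm. -/
theorem exists_directions (d : ℕ) {M : ℕ} (hM : 0 < M) :
    ∃ D : Finset (Fin d → ℝ), D.card ≤ 1 + d * (2 * (2 * M + 1) ^ (d - 1)) ∧
      (∀ u ∈ D, ‖u‖ ≤ 1) ∧ ∀ y : Fin d → ℝ, ∃ u ∈ D, ‖y - ‖y‖ • u‖ ≤ ‖y‖ / M := by
  classical
  have hM' : (0 : ℝ) < M := by exact_mod_cast hM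
  set S : Fin d → Fin d → Finset ℤ := fun i l =>
    if l = i then {(M : ℤ), -(M : ℤ)} else Finset.Icc (-(M : ℤ)) M with hS
  set Z : Finset (Fin d → ℤ) := Finset.univ.biUnion fun i => Fintype.piFinset (S i) with hZ
  set F : (Fin d → ℤ) → Fin d → ℝ := fun z l => (z l : ℝ) / M with hF
  have hSabs : ∀ i l, ∀ z ∈ S i l, |z| ≤ M := by
    intro i l z hz
    simp only [hS] at hz
    rw [abs_le]
    split_ifs at hz
    · simp only [Finset.mem_insert, Finset.mem_singleton] at hz
      omega
    · exact Finset.mem_Icc.1 hz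
  refine ⟨insert 0 (Z.image F), ?_, ?_, ?_⟩
  · have h1 : ∀ i, (Fintype.piFinset (S i)).card ≤ 2 * (2 * M + 1) ^ (d - 1) := by
      intro i
      rw [Fintype.card_piFinset, ← Finset.mul_prod_erase Finset.univ _ (Finset.mem_univ i)]
      refine Nat.mul_le_mul ?_ (le_of_eq ?_)
      · simp only [hS, if_true]
        exact Finset.card_le_two
      · rw [Finset.prod_congr rfl (g := fun _ => 2 * M + 1), Finset.prod_const,
          Finset.card_erase_of_mem (Finset.mem_univ i), Finset.card_univ, Fintype.card_fin]
        intro l hl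
        simp only [hS, if_neg (Finset.ne_of_mem_erase hl), Int.card_Icc]
        omega
    have h2 : Z.card ≤ d * (2 * (2 * M + 1) ^ (d - 1)) := by
      refine Finset.card_biUnion_le.trans ((Finset.sum_le_sum fun i _ => h1 i).trans ?_)
      simp
    have h3 := Finset.card_insert_le (0 : Fin d → ℝ) (Z.image F)
    have h4 := Finset.card_image_le (s := Z) (f := F)
    omega
  · intro u hu
    rcases Finset.mem_insert.1 hu with rfl | hu
    · simp
    obtain ⟨z, hz, rfl⟩ := Finset.mem_image.1 hu
    obtain ⟨i, -, hi⟩ := Finset.mem_biUnion.1 hz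
    rw [pi_norm_le_iff_of_nonneg zero_le_one]
    intro l
    have := hSabs i l (z l) (Fintype.mem_piFinset.1 hi l)
    simp only [hF, Real.norm_eq_abs, abs_div, abs_of_pos hM']
    rw [div_le_one hM']
    exact_mod_cast this
  · intro y
    rcases eq_or_ne y 0 with rfl | hy
    · exact ⟨0, Finset.mem_insert_self _ _, by simp⟩
    have hy0 : 0 < ‖y‖ := norm_pos_iff.2 hy
    obtain ⟨i, hi⟩ : ∃ i, |y i| = ‖y‖ := by
      by_contra! hcon
      have : ‖y‖ < ‖y‖ := by
        rw [pi_norm_lt_iff hy0]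
        exact fun i => lt_of_le_of_ne (norm_le_pi_norm y i) (hcon i)
      exact lt_irrefl _ this
    set z : Fin d → ℤ := fun l => ⌊M * (y l / ‖y‖)⌋ with hz
    refine ⟨F z, Finset.mem_insert_of_mem (Finset.mem_image_of_mem F ?_), ?_⟩
    · refine Finset.mem_biUnion.2 ⟨i, Finset.mem_univ i, Fintype.mem_piFinset.2 fun l => ?_⟩
      simp only [hS]
      split_ifs with hl
      · subst hl
        simp only [hz, Finset.mem_insert, Finset.mem_singleton]
        rcases abs_cases (y l) with ⟨h, -⟩ | ⟨h, -⟩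
        · left
          rw [← hi, h, div_self, mul_one]
          · exact Int.floor_natCast M
          · rw [← h, hi]; exact hy0.ne'
        · right
          have : y l / ‖y‖ = -1 := by
            rw [div_eq_iff hy0.ne']; linarith
          rw [this, mul_neg_one, ← Int.cast_natCast, ← Int.cast_neg, Int.floor_intCast]
      · have h1 : |y l / ‖y‖| ≤ 1 := by
          rw [abs_div, abs_of_pos hy0, div_le_one hy0]
          exact norm_le_pi_norm y l
        rw [abs_le] at h1
        rw [Finset.mem_Icc]
        constructor
        · rw [Int.le_floor]; push_cast; nlinarith
        · have : (⌊(M : ℝ) * (y l / ‖y‖)⌋ : ℝ) ≤ M := (Int.floor_le _).trans (by nlinarith)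
          exact_mod_cast this
    · rw [pi_norm_le_iff_of_nonneg (by positivity)]
      intro l
      have h1 := Int.floor_le ((M : ℝ) * (y l / ‖y‖))
      have h2 := Int.lt_floor_add_one ((M : ℝ) * (y l / ‖y‖))
      have h3 : y l - ‖y‖ * ((⌊(M : ℝ) * (y l / ‖y‖)⌋ : ℝ) / M) =
          ‖y‖ / M * (M * (y l / ‖y‖) - ⌊(M : ℝ) * (y l / ‖y‖)⌋) := by
        field_simp
      simp only [Pi.sub_apply, Pi.smul_apply, smul_eq_mul, hF, hz, Real.norm_eq_abs]
      rw [h3, abs_mul, abs_of_nonneg (by positivity : 0 ≤ ‖y‖ / M), abs_of_nonneg (by linarith)]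
      exact mul_le_of_le_one_right (by positivity) (by linarith)

/-- Optimal centres among the data points are a constant-factor approximation of arbitrary
sites. -/
theorem exists_centers {d k n : ℕ} (x : Fin n → Fin d → ℝ) {ω : Fin n → ℝ} (hω : ∀ j, 0 < ω j)
    (hk : n = 0 ∨ 0 < k) :
    ∃ (a : Fin k → Fin d → ℝ) (σ : Fin n → Fin k), ∀ (ξ : Fin k → Fin n → ℝ),
      IsClustering ξ → ∀ s : Fin k → Fin d → ℝ,
      ∑ j, ω j * ‖x j - a (σ j)‖ ^ 2 ≤ 4 * ∑ i, ∑ j, ξ i j * ω j * ‖x j - s i‖ ^ 2 := by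
  rcases Nat.eq_zero_or_pos n with rfl | hn
  · exact ⟨0, Fin.elim0, fun ξ _ s => by simp⟩
  have : Nonempty (Fin k) := ⟨⟨0, by omega⟩⟩
  have : Nonempty (Fin n) := ⟨⟨0, hn⟩⟩
  obtain ⟨⟨f, σ⟩, hmin⟩ := Finite.exists_min
    fun q : (Fin k → Fin n) × (Fin n → Fin k) => ∑ j, ω j * ‖x j - x (q.1 (q.2 j))‖ ^ 2
  refine ⟨fun i => x (f i), σ, fun ξ hξ s => ?_⟩
  choose g hg using fun i => Finite.exists_min fun j => ‖x j - s i‖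
  choose τ hτ using fun j => Finite.exists_min fun i => ‖x j - x (g i)‖
  refine (hmin (g, τ)).trans ?_
  have h1 : ∀ i j, ‖x j - x (g (τ j))‖ ^ 2 ≤ 4 * ‖x j - s i‖ ^ 2 := by
    intro i j
    have e1 := hτ j i
    have e2 : ‖x j - x (g i)‖ ≤ ‖x j - s i‖ + ‖x (g i) - s i‖ := by
      have : x j - x (g i) = (x j - s i) - (x (g i) - s i) := by abel
      rw [this]; exact norm_sub_le _ _
    have e3 := hg i j
    calc ‖x j - x (g (τ j))‖ ^ 2 ≤ (2 * ‖x j - s i‖) ^ 2 := by gcongr; linarith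
      _ = _ := by ring
  have h2 : ∑ j, ω j * ‖x j - x (g (τ j))‖ ^ 2 =
      ∑ i, ∑ j, ξ i j * (ω j * ‖x j - x (g (τ j))‖ ^ 2) := by
    rw [Finset.sum_comm]
    exact Finset.sum_congr rfl fun j _ => by rw [← Finset.sum_mul, hξ.2 j, one_mul]
  simp only
  rw [h2, Finset.mul_sum]
  refine Finset.sum_le_sum fun i _ => ?_
  rw [Finset.mul_sum]
  refine Finset.sum_le_sum fun j _ => ?_
  have := mul_le_mul_of_nonneg_left (h1 i j) (mul_nonneg (hξ.1 i j) (hω j).le)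
  linarith

/-- Four successive perturbations with relative errors `η` and absolute errors at most `2 * T`. -/
theorem accumulated_error_le {η c T : ℝ} (hη : 0 ≤ η) (hη1 : η ≤ 1) (hc : 0 ≤ c) (hT : 0 ≤ T) :
    (1 + η) * ((1 + η) * ((1 + η) * c + T) + T) + 2 * T ≤ (1 + 7 * η) * c + 8 * T := by
  have h2 : η ^ 2 ≤ η := by nlinarith
  have h3 : η ^ 3 ≤ η := by nlinarith
  have e1 : (1 + η) ^ 3 ≤ 1 + 7 * η := by
    linarith [show (1 + η) ^ 3 = 1 + 3 * η + 3 * η ^ 2 + η ^ 3 by ring]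
  have e2 : (1 + η) ^ 2 + (1 + η) + 2 ≤ 8 := by
    linarith [show (1 + η) ^ 2 = 1 + 2 * η + η ^ 2 by ring]
  have := mul_le_mul_of_nonneg_right e1 hc
  have := mul_le_mul_of_nonneg_right e2 hT
  linarith

set_option maxHeartbeats 800000 in
/-- A labelling with few labels whose averaging operation is cheap for suitable clusterings. -/
theorem exists_labels {d k n : ℕ} {lm Λ : ℝ} (hlm : 0 < lm) (hΛ0 : 0 ≤ Λ)
    (x : Fin n → Fin d → ℝ) {ω : Fin n → ℝ} (hω : ∀ j, 0 < ω j) (hk : n = 0 ∨ 0 < k)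
    (A : Fin k → Matrix (Fin d) (Fin d) ℝ)
    (hlow : ∀ i (v : Fin d → ℝ), lm * ‖v‖ ^ 2 ≤ anormSq (A i) v)
    (hΛ : ∀ i (v : Fin d → ℝ), anormSq (A i) v ≤ Λ * ‖v‖ ^ 2)
    {M N : ℕ} (hM : 0 < M) (hN : 0 < N) :
    ∃ B : Fin n → (Fin k × (Fin d → ℝ)) × ℕ,
      (Finset.univ.image B).card ≤
        k * (1 + d * (2 * (2 * M + 1) ^ (d - 1))) * (2 * N + 1) ∧
      ∀ (s : Fin k → Fin d → ℝ) (ξ : Fin k → Fin n → ℝ), IsClustering ξ →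
        ∀ η : ℝ, 0 < η → η ≤ 1 → ∃ ζ : Fin k → Fin n → ℝ, IsClustering ζ ∧
        (∀ i, clusterWeight ω ζ i = clusterWeight ω ξ i) ∧
        cost A x ω (batchAverage ω B ζ) s ≤ (1 + 7 * η +
          2 / η * (8 * Λ * (1 / (M : ℝ) ^ 2 + 4 * k / N) * (4 / lm))) * cost A x ω ξ s := by
  classical
  have hM' : (0 : ℝ) < M := by exact_mod_cast hM
  have hN' : (0 : ℝ) < N := by exact_mod_cast hN
  have hA : ∀ i v, 0 ≤ anormSq (A i) v := fun i v =>
    (mul_nonneg hlm.le (sq_nonneg ‖v‖)).trans (hlow i v)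
  obtain ⟨a, σ, hσ⟩ := exists_centers x hω hk
  obtain ⟨D, hDcard, hDnorm, hD⟩ := exists_directions d hM
  choose U hUD hU using hD
  set t : Fin n → ℝ := fun j => ‖x j - a (σ j)‖ with ht
  set ρ : Fin n → Fin k × (Fin d → ℝ) := fun j => (σ j, U (x j - a (σ j))) with hρ
  set P : Fin k × (Fin d → ℝ) → Finset (Fin n) := fun r => Finset.univ.filter fun j => ρ j = r
    with hP
  have hmemP : ∀ j, j ∈ P (ρ j) := fun j => by simp [hP]
  choose b hb hbord hbvar using fun r => exists_split ω t hω hN (P r)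
  set B : Fin n → (Fin k × (Fin d → ℝ)) × ℕ := fun j => (ρ j, b (ρ j) j) with hB
  have hρmem : ∀ j, ρ j ∈ (Finset.univ : Finset (Fin k)) ×ˢ D := fun j =>
    Finset.mem_product.2 ⟨Finset.mem_univ _, hUD _⟩
  set W : ℝ := ∑ j, ω j * t j ^ 2 with hW
  have hW0 : 0 ≤ W := Finset.sum_nonneg fun j _ => mul_nonneg (hω j).le (sq_nonneg _)
  set x' : Fin n → Fin d → ℝ := fun j => a (ρ j).1 + t j • (ρ j).2 with hx'
  have hxx' : ∑ j, ω j * ‖x j - x' j‖ ^ 2 ≤ W / M ^ 2 := by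
    rw [hW, Finset.sum_div]
    refine Finset.sum_le_sum fun j _ => ?_
    have h1 : x j - x' j = (x j - a (σ j)) - ‖x j - a (σ j)‖ • U (x j - a (σ j)) := by
      simp only [hx', hρ, ht]; abel
    have h2 := hU (x j - a (σ j))
    rw [← h1] at h2
    calc ω j * ‖x j - x' j‖ ^ 2 ≤ ω j * (t j / M) ^ 2 := by
          have := (hω j).le
          gcongr
      _ = _ := by ring
  refine ⟨B, ?_, ?_⟩
  · have hsub : Finset.univ.image B ⊆
        ((Finset.univ : Finset (Fin k)) ×ˢ D) ×ˢ Finset.range (2 * N + 1) := by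
      intro v hv
      obtain ⟨j, -, rfl⟩ := Finset.mem_image.1 hv
      exact Finset.mem_product.2 ⟨hρmem j, Finset.mem_range.2 (hb _ j (hmemP j))⟩
    refine (Finset.card_le_card hsub).trans ?_
    rw [Finset.card_product, Finset.card_product, Finset.card_univ, Fintype.card_fin,
      Finset.card_range]
    gcongr
  intro s ξ hξ η hη hη1
  obtain ⟨ζ, μ, hζ, hζw, hζc, hζμ⟩ := exists_potential ω hω
    (fun i j => anormSq (A i) (x' j - s i)) (fun i j => hA i _) hξ
  refine ⟨ζ, hζ, hζw, ?_⟩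
  choose Bad hBadcard hBad using fun r : Fin k × (Fin d → ℝ) => exists_bad_batches
    (fun i => anormSq (A i) r.2)
    (fun i => (a r.1 - s i) ⬝ᵥ A i *ᵥ r.2 + r.2 ⬝ᵥ A i *ᵥ (a r.1 - s i))
    (fun i => anormSq (A i) (a r.1 - s i) + μ i) (P r) t (b r) (hbord r)
  set fib : (Fin k × (Fin d → ℝ)) → ℕ → Finset (Fin n) := fun r v =>
    (P r).filter fun j => b r j = v with hfib
  set τ : Fin n → ℝ := fun j => if b (ρ j) j ∈ Bad (ρ j) then
    wmean ω t (fib (ρ j) (b (ρ j) j)) else t j with hτ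
  set Y : Fin n → Fin d → ℝ := fun j => a (ρ j).1 + τ j • (ρ j).2 with hY
  have hx'Y : ∑ j, ω j * ‖x' j - Y j‖ ^ 2 ≤ 4 * k / N * W := by
    have h1 : ∀ j, ω j * ‖x' j - Y j‖ ^ 2 ≤ ω j * (t j - τ j) ^ 2 := by
      intro j
      have e1 : x' j - Y j = (t j - τ j) • (ρ j).2 := by
        simp only [hx', hY, sub_smul]; abel
      have e2 : ‖x' j - Y j‖ ≤ |t j - τ j| := by
        rw [e1, norm_smul, Real.norm_eq_abs]
        exact mul_le_of_le_one_right (abs_nonneg _) (hDnorm _ (hUD _))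
      have := (hω j).le
      rw [← sq_abs (t j - τ j)]
      gcongr
    have h2 : ∀ r, ∑ j ∈ P r, ω j * (t j - τ j) ^ 2 ≤
        4 * k / N * ∑ j ∈ P r, ω j * t j ^ 2 := by
      intro r
      have hPr : ∀ j ∈ P r, ρ j = r := fun j hj => (Finset.mem_filter.1 hj).2
      have e1 : ∑ j ∈ P r, ω j * (t j - τ j) ^ 2 =
          ∑ j ∈ (P r).filter fun j => b r j ∈ Bad r, ω j * (t j - τ j) ^ 2 := by
        symm
        apply Finset.sum_filter_of_ne
        intro j hj hne
        by_contra hnb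
        apply hne
        have : τ j = t j := by simp only [hτ, hPr j hj, if_neg hnb]
        rw [this, sub_self]; ring
      rw [e1, ← Finset.sum_fiberwise_of_maps_to (t := Bad r) (g := b r)
        (fun j hj => (Finset.mem_filter.1 hj).2)]
      have e2 : ∀ v ∈ Bad r, ∑ j ∈ ((P r).filter fun j => b r j ∈ Bad r) with b r j = v,
          ω j * (t j - τ j) ^ 2 ≤ (∑ j ∈ P r, ω j * t j ^ 2) / N := by
        intro v hv
        refine le_trans (le_of_eq ?_) (hbvar r v)
        have e3 : ((P r).filter fun j => b r j ∈ Bad r).filter (fun j => b r j = v) =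
            fib r v := by
          ext j
          simp only [hfib, Finset.mem_filter]
          constructor
          · rintro ⟨⟨h1, -⟩, h2⟩; exact ⟨h1, h2⟩
          · rintro ⟨h1, h2⟩; exact ⟨⟨h1, h2 ▸ hv⟩, h2⟩
        rw [e3, wvar]
        refine Finset.sum_congr rfl fun j hj => ?_
        obtain ⟨hj1, hj2⟩ := Finset.mem_filter.1 hj
        have : τ j = wmean ω t (fib r v) := by
          simp only [hτ, hPr j hj1, hj2, if_pos hv]
        rw [this]
      refine (Finset.sum_le_sum e2).trans ?_
      rw [Finset.sum_const, nsmul_eq_mul]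
      have e4 : ((Bad r).card : ℝ) ≤ 4 * k := by exact_mod_cast hBadcard r
      have e5 : 0 ≤ (∑ j ∈ P r, ω j * t j ^ 2) / N := div_nonneg
        (Finset.sum_nonneg fun j _ => mul_nonneg (hω j).le (sq_nonneg _)) hN'.le
      refine (mul_le_mul_of_nonneg_right e4 e5).trans (le_of_eq ?_)
      ring
    have h3 : ∀ h : Fin n → ℝ, ∑ j, h j =
        ∑ r ∈ (Finset.univ : Finset (Fin k)) ×ˢ D, ∑ j ∈ P r, h j := fun h =>
      (Finset.sum_fiberwise_of_maps_to (fun j _ => hρmem j) h).symm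
    refine (Finset.sum_le_sum fun j _ => h1 j).trans ?_
    rw [hW, h3, h3, Finset.mul_sum]
    exact Finset.sum_le_sum fun r _ => h2 r
  have hxY : ∑ j, ω j * ‖x j - Y j‖ ^ 2 ≤ 2 * (W / M ^ 2) + 2 * (4 * k / N * W) := by
    have h1 : ∀ j, ω j * ‖x j - Y j‖ ^ 2 ≤
        2 * (ω j * ‖x j - x' j‖ ^ 2) + 2 * (ω j * ‖x' j - Y j‖ ^ 2) := by
      intro j
      have e1 : ‖x j - Y j‖ ≤ ‖x j - x' j‖ + ‖x' j - Y j‖ := norm_sub_le_norm_sub_add_norm_sub _ _ _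
      have e2 : ‖x j - Y j‖ ^ 2 ≤ 2 * ‖x j - x' j‖ ^ 2 + 2 * ‖x' j - Y j‖ ^ 2 := by
        nlinarith [norm_nonneg (x j - Y j), sq_nonneg (‖x j - x' j‖ - ‖x' j - Y j‖)]
      have := mul_le_mul_of_nonneg_left e2 (hω j).le
      linarith
    refine (Finset.sum_le_sum fun j _ => h1 j).trans ?_
    rw [Finset.sum_add_distrib, ← Finset.mul_sum, ← Finset.mul_sum]
    linarith
  have havg : cost A Y ω (batchAverage ω B ζ) s = cost A Y ω ζ s := by
    have hex : ∀ j, ∃ i, 0 < ζ i j := by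
      intro j
      by_contra! hcon
      have h1 := hζ.2 j
      rw [Finset.sum_eq_zero fun i _ => le_antisymm (hcon i) (hζ.1 i j)] at h1
      exact zero_ne_one h1
    choose i₀ hi₀ using hex
    have hBeq : ∀ j l, B j = B l → ρ j = ρ l ∧ b (ρ j) j = b (ρ l) l := fun j l h =>
      ⟨(Prod.ext_iff.1 h).1, (Prod.ext_iff.1 h).2⟩
    refine sum_batchAverage_eq hω B hζ (fun i j => anormSq (A i) (Y j - s i))
      (fun j => if b (ρ j) j ∈ Bad (ρ j) then 0 else
        anormSq (A (i₀ j)) (x' j - s (i₀ j)) + μ (i₀ j))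
      (fun i j => if b (ρ j) j ∈ Bad (ρ j) then anormSq (A i) (Y j - s i) else -μ i) ?_ ?_
    · intro i j l hjl
      obtain ⟨h1, h2⟩ := hBeq j l hjl
      simp only [hY, hτ]
      rw [h2, h1]
      split_ifs <;> rfl
    · intro i j l hjl hil
      obtain ⟨h1, h2⟩ := hBeq j l hjl
      by_cases hbad : b (ρ j) j ∈ Bad (ρ j)
      · simp only [if_pos hbad, zero_add]
      · simp only [if_neg hbad]
        have hYx : Y j = x' j := by simp only [hY, hτ, hx', if_neg hbad]
        rw [hYx]
        have hquad : ∀ (m : Fin n), ρ m = ρ l → ∀ i', anormSq (A i') (x' m - s i') + μ i' =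
            anormSq (A i') (ρ l).2 * t m ^ 2 + ((a (ρ l).1 - s i') ⬝ᵥ A i' *ᵥ (ρ l).2 +
              (ρ l).2 ⬝ᵥ A i' *ᵥ (a (ρ l).1 - s i')) * t m +
              (anormSq (A i') (a (ρ l).1 - s i') + μ i') := by
          intro m hm i'
          simp only [hx', hm]
          rw [anormSq_ray]
          ring
        have hlP : l ∈ P (ρ l) := hmemP l
        have hjP : j ∈ P (ρ l) := h1 ▸ hmemP j
        have hbb : b (ρ l) l = b (ρ l) j := by rw [← h2, h1]
        have hnb : b (ρ l) l ∉ Bad (ρ l) := by rw [← h2, ← h1]; exact hbad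
        have key := hBad (ρ l) l hlP j hjP hbb hnb i (fun i' => by
          have := hζμ i l hil i'
          rw [hquad l rfl, hquad l rfl] at this
          exact this) (i₀ j)
        rw [← hquad j h1, ← hquad j h1] at key
        have key2 := hζμ (i₀ j) j (hi₀ j) i
        linarith
  set E : ℝ := W * (1 / (M : ℝ) ^ 2 + 4 * k / N) with hE
  have hE0 : 0 ≤ E := by positivity
  have hWcost : W ≤ 4 / lm * cost A x ω ξ s := by
    refine (hσ ξ hξ s).trans ?_
    rw [div_mul_eq_mul_div, mul_div_assoc]
    refine mul_le_mul_of_nonneg_left ?_ (by norm_num)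
    rw [le_div_iff₀ hlm, cost, Finset.sum_mul]
    refine Finset.sum_le_sum fun i _ => ?_
    rw [Finset.sum_mul]
    refine Finset.sum_le_sum fun j _ => ?_
    have := mul_le_mul_of_nonneg_left (hlow i (x j - s i)) (mul_nonneg (hξ.1 i j) (hω j).le)
    linarith
  have hE1 : W / (M : ℝ) ^ 2 ≤ E := by
    have : 0 ≤ W * (4 * k / N) := by positivity
    rw [hE, mul_add, mul_one_div]; linarith
  have hE2 : 4 * k / N * W ≤ E := by
    have : 0 ≤ W * (1 / (M : ℝ) ^ 2) := by positivity
    rw [hE, mul_add]; linarith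
  have hE3 : 2 * (W / (M : ℝ) ^ 2) + 2 * (4 * k / N * W) = 2 * E := by
    rw [hE]; ring
  have hη' : 0 < 1 + 1 / η := by positivity
  have mv : ∀ {q e : ℝ}, q ≤ e → (1 + 1 / η) * (Λ * q) ≤ (1 + 1 / η) * (Λ * e) := fun h =>
    mul_le_mul_of_nonneg_left (mul_le_mul_of_nonneg_left h hΛ0) hη'.le
  have c1 := cost_le_of_move hA hΛ x' x hω hξ s hη
  have c1' := mv (show ∑ j, ω j * ‖x' j - x j‖ ^ 2 ≤ E from by
    simp only [norm_sub_rev (x' _)]; exact hxx'.trans hE1)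
  have c2 : cost A x' ω ζ s ≤ cost A x' ω ξ s := hζc
  have c3 := cost_le_of_move hA hΛ Y x' hω hζ s hη
  have c3' := mv (show ∑ j, ω j * ‖Y j - x' j‖ ^ 2 ≤ E from by
    simp only [norm_sub_rev (Y _)]; exact hx'Y.trans hE2)
  have c4 := cost_le_of_move hA hΛ x Y hω (isClustering_batchAverage hω B hζ) s hη
  rw [havg] at c4
  have c4' := mv (hxY.trans hE3.le)
  have hc0 := cost_nonneg hA x hω hξ s
  set c := cost A x ω ξ s with hc
  set T := (1 + 1 / η) * (Λ * E) with hT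
  have hT0 : 0 ≤ T := by positivity
  have hT2 : (1 + 1 / η) * (Λ * (2 * E)) = 2 * T := by rw [hT]; ring
  have d1 : cost A x' ω ζ s ≤ (1 + η) * c + T := by linarith
  have d2 : cost A Y ω ζ s ≤ (1 + η) * ((1 + η) * c + T) + T := by
    have := mul_le_mul_of_nonneg_left d1 (by linarith : 0 ≤ 1 + η)
    linarith
  have d3 : cost A x ω (batchAverage ω B ζ) s ≤
      (1 + η) * ((1 + η) * ((1 + η) * c + T) + T) + 2 * T := by
    have := mul_le_mul_of_nonneg_left d2 (by linarith : 0 ≤ 1 + η)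
    linarith
  have d4 := accumulated_error_le hη.le hη1 hc0 hT0
  have d5 : T ≤ 2 / η * (Λ * E) := by
    refine mul_le_mul_of_nonneg_right ?_ (by positivity)
    have : 1 ≤ 1 / η := by rw [le_div_iff₀ hη]; linarith
    have : 2 / η = 1 / η + 1 / η := by ring
    linarith
  have d6 : E ≤ (1 / (M : ℝ) ^ 2 + 4 * k / N) * (4 / lm) * c := by
    have := mul_le_mul_of_nonneg_left hWcost
      (by positivity : 0 ≤ 1 / (M : ℝ) ^ 2 + 4 * k / N)
    rw [hE]; linarith
  have d7 : 2 / η * (Λ * E) ≤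
      2 / η * (Λ * ((1 / (M : ℝ) ^ 2 + 4 * k / N) * (4 / lm) * c)) := by
    gcongr
  linarith

end Construction

/-- The number of labels is of the order `k ^ 2 / ε ^ (d + 1)`. -/
theorem card_bound {d k M N : ℕ} {K ε : ℝ} (hd : 0 < d) (hk : 0 < k) (hK : 1 ≤ K) (hε : 0 < ε)
    (hε1 : ε ≤ 1) (hM : (M : ℝ) ≤ 3 * K / ε) (hN : (N : ℝ) ≤ 9 * k * K / ε ^ 2) :
    (k : ℝ) * (1 + d * (2 * (2 * M + 1) ^ (d - 1))) * (2 * N + 1) ≤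
      ((1 + 2 * d) * (7 * K) ^ (d - 1) * (19 * K)) * (k : ℝ) ^ 2 / ε ^ (d + 1) := by
  obtain ⟨e, rfl⟩ : ∃ e, d = e + 1 := ⟨d - 1, by omega⟩
  simp only [Nat.add_sub_cancel]
  have hk1 : (1 : ℝ) ≤ k := by exact_mod_cast hk
  have h0 : 1 ≤ K / ε := by rw [le_div_iff₀ hε]; linarith
  have h1 : 2 * (M : ℝ) + 1 ≤ 7 * K / ε := by
    have : 7 * K / ε = 2 * (3 * K / ε) + K / ε := by ring
    linarith
  have hpow : 1 ≤ (7 * K / ε) ^ e := one_le_pow₀ (by rw [le_div_iff₀ hε]; linarith)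
  have h2 : 2 * (N : ℝ) + 1 ≤ 19 * k * K / ε ^ 2 := by
    have e1 : 1 ≤ k * K / ε ^ 2 := by
      rw [le_div_iff₀ (by positivity)]
      nlinarith
    have : 19 * k * K / ε ^ 2 = 2 * (9 * k * K / ε ^ 2) + k * K / ε ^ 2 := by ring
    linarith
  have h3 : (1 : ℝ) + ((e + 1 : ℕ) : ℝ) * (2 * (2 * M + 1) ^ e) ≤
      (1 + 2 * ((e + 1 : ℕ) : ℝ)) * (7 * K / ε) ^ e := by
    have e1 : (2 * (M : ℝ) + 1) ^ e ≤ (7 * K / ε) ^ e := by gcongr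
    have := mul_le_mul_of_nonneg_left e1 (Nat.cast_nonneg (α := ℝ) (e + 1))
    linarith
  calc (k : ℝ) * (1 + ((e + 1 : ℕ) : ℝ) * (2 * (2 * M + 1) ^ e)) * (2 * N + 1)
      ≤ k * ((1 + 2 * ((e + 1 : ℕ) : ℝ)) * (7 * K / ε) ^ e) * (19 * k * K / ε ^ 2) := by
        gcongr
    _ = _ := by
        rw [div_pow]
        field_simp
        ring

/-- The relative error for the chosen parameters is at most `ε`. -/
theorem relative_error_le {k M N : ℕ} {lm Λ ε K : ℝ} (hlm : 0 < lm) (hΛ : 0 ≤ Λ)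
    (hKΛ : 1792 * Λ / lm ≤ K) (hK : 1 ≤ K) (hk : 0 < k) (hε : 0 < ε)
    (hM : 2 * K / ε ≤ M) (hN : 8 * k * K / ε ^ 2 ≤ N) :
    7 * (ε / 14) + 2 / (ε / 14) * (8 * Λ * (1 / (M : ℝ) ^ 2 + 4 * k / N) * (4 / lm)) ≤ ε := by
  have hK0 : 0 < K := by linarith
  have hk' : (0 : ℝ) < k := by exact_mod_cast hk
  have h1 : 1 / (M : ℝ) ^ 2 ≤ ε ^ 2 / (2 * K) := by
    have e1 : (2 * K / ε) ^ 2 ≤ (M : ℝ) ^ 2 := by gcongr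
    have e2 : 2 * K / ε ^ 2 ≤ (M : ℝ) ^ 2 := by
      refine le_trans ?_ e1
      rw [div_pow]
      gcongr
      nlinarith
    calc 1 / (M : ℝ) ^ 2 ≤ 1 / (2 * K / ε ^ 2) := by gcongr
      _ = _ := by rw [one_div_div]
  have h2 : 4 * (k : ℝ) / N ≤ ε ^ 2 / (2 * K) := by
    calc 4 * (k : ℝ) / N ≤ 4 * k / (8 * k * K / ε ^ 2) := by gcongr
      _ = _ := by field_simp; norm_num
  have h3 : 2 / (ε / 14) * (8 * Λ * (1 / (M : ℝ) ^ 2 + 4 * k / N) * (4 / lm)) ≤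
      2 / (ε / 14) * (8 * Λ * (ε ^ 2 / (2 * K) + ε ^ 2 / (2 * K)) * (4 / lm)) := by
    gcongr
  have h4 : 2 / (ε / 14) * (8 * Λ * (ε ^ 2 / (2 * K) + ε ^ 2 / (2 * K)) * (4 / lm)) =
      (1792 * Λ / lm) * (ε / (2 * K)) := by
    field_simp
    ring
  have h5 : (1792 * Λ / lm) * (ε / (2 * K)) ≤ K * (ε / (2 * K)) := by gcongr
  have h6 : K * (ε / (2 * K)) = ε / 2 := by field_simp
  linarith

theorem statement11 (d : ℕ) (lm lp : ℝ) (hlm : 0 < lm) (hlmp : lm ≤ lp) :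
    ∃ c : ℝ, 0 < c ∧
      ∀ (k n : ℕ) (x : Fin n → Fin d → ℝ) (ω : Fin n → ℝ), (∀ j, 0 < ω j) →
      ∀ (κlo κhi : Fin k → ℝ), (∀ i, κlo i ≤ κhi i) →
      ∀ (A : Fin k → Matrix (Fin d) (Fin d) ℝ),
        (∀ i, (A i).PosDef) →
        (∀ i (u : Fin d → ℝ), lm * (u ⬝ᵥ u) ≤ anormSq (A i) u) →
        (∀ i (u : Fin d → ℝ), anormSq (A i) u ≤ lp * (u ⬝ᵥ u)) →
        (∃ ξ, IsWCC κlo κhi ω ξ) →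
        ∀ ε : ℝ, 0 < ε → ε ≤ 1 / 2 → ∀ δ : ℝ, lp / lm ≤ δ →
        ∃ (m : ℕ) (x' : Fin m → Fin d → ℝ) (ω' : Fin m → ℝ),
          (∀ j', 0 < ω' j') ∧
          (∃ f Δp Δm, IsCoresetWith ε δ κlo κhi A x ω x' ω' f Δp Δm) ∧
          (m : ℝ) ≤ c * (k : ℝ) ^ 2 / ε ^ (d + 1) := by
  set K : ℝ := 1792 * (lp * d) / lm + 1 with hKdef
  have hlp : 0 < lp := hlm.trans_le hlmp
  have hΛ0 : 0 ≤ lp * d := by positivity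
  have hK : 1 ≤ K := by
    have : 0 ≤ 1792 * (lp * d) / lm := by positivity
    linarith
  have hc : 0 ≤ (1 + 2 * (d : ℝ)) * (7 * K) ^ (d - 1) * (19 * K) := by positivity
  refine ⟨(1 + 2 * d) * (7 * K) ^ (d - 1) * (19 * K) + 1, by linarith, ?_⟩
  intro k n x ω hω κlo κhi _ A _ hlow hup hne ε hε hε2 δ hδ
  have hk : n = 0 ∨ 0 < k := by
    by_contra! h
    obtain ⟨hn, hk⟩ := h
    obtain rfl : k = 0 := by omega
    obtain ⟨ξ, hξ, -⟩ := hne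
    have := hξ.2 ⟨0, by omega⟩
    simp at this
  have hR : 0 ≤ (k : ℝ) ^ 2 / ε ^ (d + 1) := by positivity
  by_cases hsmall : n = 0 ∨ d = 0
  · obtain ⟨x', ω', hω', hf⟩ := exists_coreset_of_labels hlm hlmp x hω κlo κhi A hlow hup hne hε
      hδ (fun _ => ()) (fun s ξ hξ => ⟨ξ, hξ, fun _ => rfl, le_of_eq (by
        rcases hsmall with rfl | rfl <;> simp [cost, anormSq])⟩)
    refine ⟨_, x', ω', hω', hf, ?_⟩
    rw [mul_div_assoc]
    rcases Nat.eq_zero_or_pos n with rfl | hn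
    · simpa using mul_nonneg (by linarith) hR
    have hk1 : (1 : ℝ) ≤ k := by
      have : 0 < k := hk.resolve_left (by omega)
      exact_mod_cast this
    have h1 : (1 : ℝ) ≤ (k : ℝ) ^ 2 / ε ^ (d + 1) := by
      rw [le_div_iff₀ (by positivity), one_mul]
      exact (pow_le_one₀ hε.le (by linarith)).trans (one_le_pow₀ hk1)
    have h2 : ((Finset.univ.image fun _ : Fin n => ()).card : ℝ) ≤ 1 := by
      exact_mod_cast Finset.card_le_one_of_subsingleton _
    nlinarith
  push Not at hsmall
  have hk0 : 0 < k := hk.resolve_left hsmall.1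
  have hk1 : (1 : ℝ) ≤ k := by exact_mod_cast hk0
  have hlow' : ∀ i (v : Fin d → ℝ), lm * ‖v‖ ^ 2 ≤ anormSq (A i) v := fun i v =>
    (mul_le_mul_of_nonneg_left (norm_sq_le_dotProduct_self v) hlm.le).trans (hlow i v)
  have hup' : ∀ i (v : Fin d → ℝ), anormSq (A i) v ≤ lp * d * ‖v‖ ^ 2 := fun i v =>
    ((hup i v).trans (mul_le_mul_of_nonneg_left (dotProduct_self_le_norm_sq v) hlp.le)).trans
      (by rw [mul_assoc])
  have hMpos : 0 < 2 * K / ε := by positivity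
  have hNpos : 0 < 8 * k * K / ε ^ 2 := by positivity
  obtain ⟨B, hcard, hB⟩ := exists_labels hlm hΛ0 x hω hk A hlow' hup' (Nat.ceil_pos.2 hMpos)
    (Nat.ceil_pos.2 hNpos)
  have herr := relative_error_le hlm hΛ0 (K := K) (by linarith) hK hk0 hε
    (Nat.le_ceil (2 * K / ε)) (Nat.le_ceil (8 * k * K / ε ^ 2))
  obtain ⟨x', ω', hω', hf⟩ := exists_coreset_of_labels hlm hlmp x hω κlo κhi A hlow hup hne hε
    hδ B (fun s ξ hξ => by
      obtain ⟨ζ, h1, h2, h3⟩ := hB s ξ hξ (ε / 14) (by linarith) (by linarith)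
      have h4 := cost_nonneg (fun i v => (mul_nonneg hlm.le (sq_nonneg ‖v‖)).trans (hlow' i v))
        x hω hξ s
      exact ⟨ζ, h1, h2, h3.trans (mul_le_mul_of_nonneg_right (by linarith) h4)⟩)
  refine ⟨_, x', ω', hω', hf, ?_⟩
  have h1 : 1 ≤ K / ε := by rw [le_div_iff₀ hε]; linarith
  have h2 : 1 ≤ k * K / ε ^ 2 := by
    rw [le_div_iff₀ (by positivity)]
    nlinarith
  have hM := (Nat.ceil_lt_add_one hMpos.le).le
  have hN := (Nat.ceil_lt_add_one hNpos.le).le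
  have hbound := card_bound (Nat.pos_of_ne_zero hsmall.2) hk0 hK hε (by linarith)
    (hM.trans (by
      have : 3 * K / ε = 2 * K / ε + K / ε := by ring
      linarith))
    (hN.trans (by
      have : 9 * k * K / ε ^ 2 = 8 * k * K / ε ^ 2 + k * K / ε ^ 2 := by ring
      linarith))
  have hcard' : ((Finset.univ.image B).card : ℝ) ≤ _ := Nat.cast_le.2 hcard
  push_cast at hcard'
  refine (hcard'.trans hbound).trans ?_
  rw [mul_div_assoc, mul_div_assoc]
  exact mul_le_mul_of_nonneg_right (by linarith) hR

end
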